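/- Let J₀ : ℝ → ℝ be defined by J₀(z) = (1/π) ∫₀^π cos(z sin θ) dθ, let Y₀ : (0,∞) → ℝ be defined by Y₀(z) = −(2/π) ∫₀^∞ cos(z cosh t) dt, and set H₀⁻(z) = J₀(z) − i Y₀(z) for z > 0. Let λ₁ ∈ (0, 1/4] and let χ : ℝ → [0,1] be a smooth function with χ(λ) = 1 for 0 ≤ λ ≤ λ₁ and χ(λ) = 0 for λ ≥ 2λ₁. Then for every ε ∈ (0,1) there exists a constant C (depending on χ and ε) such that for all fixed constants r, s > 0: |∫₀^∞ (H₀⁻)′(λr) · J₀″(λs) · λ² · χ(λ) dλ| ≤ C · [ 1/(√(rs) · ⟨r − s⟩^{2−ε}) + 1/(r · ⟨r + s⟩²) ]. -/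

import Mathlib

open MeasureTheory Real Filter

/-- The Bessel function of the first kind of order zero,
`J₀(z) = (1/π) ∫₀^π cos(z sin θ) dθ`. -/
noncomputable def J0 (z : ℝ) : ℝ :=
  (1 / Real.pi) * ∫ θ in (0:ℝ)..Real.pi, Real.cos (z * Real.sin θ)

/-- `f` solves the Bessel equation of order zero on `(0, ∞)`, with derivative `f₁`. -/
def SolvesBessel (f f₁ : ℝ → ℝ) : Prop :=
  ∀ z : ℝ, 0 < z → HasDerivAt f (f₁ z) z ∧ HasDerivAt f₁ (-f₁ z / z - f z) z

theorem SolvesBessel.const_mul {f f₁ : ℝ → ℝ} (h : SolvesBessel f f₁) (c : ℝ) :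
    SolvesBessel (fun z => c * f z) (fun z => c * f₁ z) := by
  intro z hz
  refine ⟨(h z hz).1.const_mul c, ?_⟩
  exact ((h z hz).2.const_mul c).congr_deriv (by ring)

theorem hasDerivAt_integral_cos {k h : ℝ → ℝ} (hk : Continuous k) (hh : Continuous h)
    (a b z : ℝ) :
    HasDerivAt (fun z => ∫ t in a..b, k t * Real.cos (z * h t))
      (∫ t in a..b, -(k t * h t * Real.sin (z * h t))) z := by
  refine (intervalIntegral.hasDerivAt_integral_of_dominated_loc_of_deriv_le
    (F := fun z t => k t * Real.cos (z * h t))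
    (F' := fun z t => -(k t * h t * Real.sin (z * h t)))
    (bound := fun t => |k t * h t|) (s := Set.univ) Filter.univ_mem
    (Eventually.of_forall fun x => ?_) ?_ ?_ ?_ ?_ ?_).2
  · exact (by fun_prop : Continuous fun t => k t * Real.cos (x * h t)).aestronglyMeasurable
  · exact (by fun_prop : Continuous fun t => k t * Real.cos (z * h t)).intervalIntegrable _ _
  · exact (by fun_prop : Continuous fun t => -(k t * h t * Real.sin (z * h t))).aestronglyMeasurable
  · refine ae_of_all _ fun t _ x _ => ?_
    rw [norm_neg, norm_mul, Real.norm_eq_abs, Real.norm_eq_abs]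
    exact mul_le_of_le_one_right (abs_nonneg _) (Real.abs_sin_le_one _)
  · exact (by fun_prop : Continuous fun t => |k t * h t|).intervalIntegrable _ _
  · refine ae_of_all _ fun t _ x _ => ?_
    have := ((hasDerivAt_mul_const (x := x) (h t)).cos).const_mul (k t)
    exact this.congr_deriv (by ring)

theorem hasDerivAt_integral_sin {k h : ℝ → ℝ} (hk : Continuous k) (hh : Continuous h)
    (a b z : ℝ) :
    HasDerivAt (fun z => ∫ t in a..b, k t * Real.sin (z * h t))
      (∫ t in a..b, k t * h t * Real.cos (z * h t)) z := by
  refine (intervalIntegral.hasDerivAt_integral_of_dominated_loc_of_deriv_le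
    (F := fun z t => k t * Real.sin (z * h t))
    (F' := fun z t => k t * h t * Real.cos (z * h t))
    (bound := fun t => |k t * h t|) (s := Set.univ) Filter.univ_mem
    (Eventually.of_forall fun x => ?_) ?_ ?_ ?_ ?_ ?_).2
  · exact (by fun_prop : Continuous fun t => k t * Real.sin (x * h t)).aestronglyMeasurable
  · exact (by fun_prop : Continuous fun t => k t * Real.sin (z * h t)).intervalIntegrable _ _
  · exact (by fun_prop : Continuous fun t => k t * h t * Real.cos (z * h t)).aestronglyMeasurable
  · refine ae_of_all _ fun t _ x _ => ?_
    rw [norm_mul, Real.norm_eq_abs, Real.norm_eq_abs]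
    exact mul_le_of_le_one_right (abs_nonneg _) (Real.abs_cos_le_one _)
  · exact (by fun_prop : Continuous fun t => |k t * h t|).intervalIntegrable _ _
  · refine ae_of_all _ fun t _ x _ => ?_
    have := ((hasDerivAt_mul_const (x := x) (h t)).sin).const_mul (k t)
    exact this.congr_deriv (by ring)

/-- The derivative of `J₀`. -/
noncomputable def J0' (z : ℝ) : ℝ :=
  -(1 / π) * ∫ θ in (0:ℝ)..π, Real.sin θ * Real.sin (z * Real.sin θ)

theorem hasDerivAt_J0 (z : ℝ) : HasDerivAt J0 (J0' z) z := by
  have := (hasDerivAt_integral_cos (k := fun _ => 1) continuous_const Real.continuous_sin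
    0 π z).const_mul (1 / π)
  simp only [one_mul, intervalIntegral.integral_neg] at this
  refine this.congr_deriv ?_
  rw [J0']
  ring

theorem hasDerivAt_J0' (z : ℝ) : HasDerivAt J0'
    (-(1 / π) * ∫ θ in (0:ℝ)..π, Real.sin θ * Real.sin θ * Real.cos (z * Real.sin θ)) z :=
  (hasDerivAt_integral_sin Real.continuous_sin Real.continuous_sin 0 π z).const_mul (-(1 / π))

theorem solvesBessel_J0 : SolvesBessel J0 J0' := by
  intro z hz
  refine ⟨hasDerivAt_J0 z, ?_⟩
  refine (hasDerivAt_J0' z).congr_deriv ?_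
  have key : ∫ θ in (0:ℝ)..π, (z * Real.cos (z * Real.sin θ) -
      Real.sin θ * Real.sin (z * Real.sin θ) -
      z * (Real.sin θ * Real.sin θ * Real.cos (z * Real.sin θ))) = 0 := by
    rw [intervalIntegral.integral_eq_sub_of_hasDerivAt
      (f := fun θ => Real.cos θ * Real.sin (z * Real.sin θ))]
    · simp
    · intro θ _
      have := (Real.hasDerivAt_cos θ).mul (((Real.hasDerivAt_sin θ).const_mul z).sin)
      refine this.congr_deriv ?_
      linear_combination (z * Real.cos (z * Real.sin θ)) * Real.sin_sq_add_cos_sq θ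
    · exact Continuous.intervalIntegrable (by fun_prop) _ _
  rw [intervalIntegral.integral_sub (Continuous.intervalIntegrable (by fun_prop) _ _)
      (Continuous.intervalIntegrable (by fun_prop) _ _),
    intervalIntegral.integral_sub (Continuous.intervalIntegrable (by fun_prop) _ _)
      (Continuous.intervalIntegrable (by fun_prop) _ _),
    intervalIntegral.integral_const_mul, intervalIntegral.integral_const_mul] at key
  rw [J0', J0]
  generalize (∫ θ in (0:ℝ)..π, Real.cos (z * Real.sin θ)) = I₀ at key ⊢
  generalize (∫ θ in (0:ℝ)..π, Real.sin θ * Real.sin (z * Real.sin θ)) = I₁ at key ⊢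
  generalize (∫ θ in (0:ℝ)..π, Real.sin θ * Real.sin θ * Real.cos (z * Real.sin θ)) = I₂ at key ⊢
  have hπ := Real.pi_ne_zero
  field_simp
  linear_combination key

theorem abs_J0_le_one (z : ℝ) : |J0 z| ≤ 1 := by
  have h : ‖∫ θ in (0:ℝ)..π, Real.cos (z * Real.sin θ)‖ ≤ 1 * |π - 0| :=
    intervalIntegral.norm_integral_le_of_norm_le_const fun θ _ => Real.abs_cos_le_one _
  rw [sub_zero, abs_of_pos Real.pi_pos, one_mul, Real.norm_eq_abs] at h
  rw [J0, abs_mul, abs_of_pos (by positivity : (0:ℝ) < 1 / π), one_div,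
    inv_mul_le_iff₀ Real.pi_pos]
  simpa using h

theorem abs_J0'_le {z : ℝ} (hz : 0 ≤ z) : |J0' z| ≤ z := by
  have h : ‖∫ θ in (0:ℝ)..π, Real.sin θ * Real.sin (z * Real.sin θ)‖ ≤ z * |π - 0| := by
    refine intervalIntegral.norm_integral_le_of_norm_le_const fun θ _ => ?_
    rw [Real.norm_eq_abs, abs_mul]
    have h1 : |Real.sin (z * Real.sin θ)| ≤ z * |Real.sin θ| := by
      simpa [abs_mul, abs_of_nonneg hz] using Real.abs_sin_le_abs (x := z * Real.sin θ)
    have h2 := Real.abs_sin_le_one θ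
    have h3 := abs_nonneg (Real.sin θ)
    calc |Real.sin θ| * |Real.sin (z * Real.sin θ)| ≤ 1 * (z * 1) := by gcongr; nlinarith
      _ = z := by ring
  rw [sub_zero, abs_of_pos Real.pi_pos, Real.norm_eq_abs] at h
  rw [J0', abs_mul, abs_neg, abs_of_pos (by positivity : (0:ℝ) < 1 / π), one_div,
    inv_mul_le_iff₀ Real.pi_pos]
  linarith

/-- Solutions of the Bessel equation decay like `z ^ (-1/2)` at infinity. -/
theorem SolvesBessel.exists_decay {f f₁ : ℝ → ℝ} (h : SolvesBessel f f₁) :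
    ∃ C : ℝ, 0 < C ∧ ∀ z : ℝ, 1 ≤ z → |f z| ≤ C / √z ∧ |f₁ z| ≤ C / √z := by
  set E : ℝ → ℝ := fun z => z * f₁ z ^ 2 + f z * f₁ z + (z + 1 / (2 * z)) * f z ^ 2 with hE
  have hd : ∀ z : ℝ, 0 < z → HasDerivAt E (-(f z ^ 2) / (2 * z ^ 2)) z := by
    intro z hz
    obtain ⟨h0, h1⟩ := h z hz
    have hz' := hz.ne'
    have e1 := (hasDerivAt_id z).mul (h1.pow 2)
    have e2 := h0.mul h1
    have e3 : HasDerivAt (fun z : ℝ => z + (2 * z)⁻¹) (1 + -(2 * 1) / (2 * z) ^ 2) z :=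
      (hasDerivAt_id z).add (((hasDerivAt_id z).const_mul 2).inv (by simpa using hz'))
    have := (e1.add e2).add (e3.mul (h0.pow 2))
    have hE' : E = id * f₁ ^ 2 + f * f₁ + (fun z => z + (2 * z)⁻¹) * f ^ 2 := by
      ext x
      simp [hE]
    rw [hE']
    refine this.congr_deriv ?_
    simp only [Pi.pow_apply, id]
    push_cast
    field_simp
    ring
  have anti : AntitoneOn E (Set.Ici 1) := by
    refine antitoneOn_of_deriv_nonpos (convex_Ici 1)
      (fun z hz => (hd z (lt_of_lt_of_le one_pos hz)).continuousAt.continuousWithinAt) ?_ ?_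
    · intro z hz
      rw [interior_Ici] at hz
      exact (hd z (one_pos.trans hz)).differentiableAt.differentiableWithinAt
    · intro z hz
      rw [interior_Ici] at hz
      rw [(hd z (one_pos.trans hz)).deriv, neg_div]
      exact neg_nonpos.2 (by positivity)
  have hlow : ∀ z : ℝ, 0 < z → z * f z ^ 2 + z * f₁ z ^ 2 / 2 ≤ E z := by
    intro z hz
    have : E z - (z * f z ^ 2 + z * f₁ z ^ 2 / 2) = (z * f₁ z + f z) ^ 2 / (2 * z) := by
      simp only [hE]
      field_simp
      ring
    have h2 : 0 ≤ (z * f₁ z + f z) ^ 2 / (2 * z) := by positivity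
    linarith
  refine ⟨√(2 * E 1) + 1, by positivity, fun z hz => ?_⟩
  have hz0 : 0 < z := by linarith
  have h1 := anti (Set.mem_Ici.2 le_rfl) (Set.mem_Ici.2 hz) hz
  have h2 := hlow z hz0
  have aux : ∀ y : ℝ, z * y ^ 2 ≤ 2 * E 1 → |y| ≤ (√(2 * E 1) + 1) / √z := by
    intro y hy
    rw [le_div_iff₀ (Real.sqrt_pos.2 hz0)]
    have : |y| * √z ≤ √(2 * E 1) := by
      refine Real.le_sqrt_of_sq_le ?_
      rw [mul_pow, sq_abs, Real.sq_sqrt hz0.le]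
      linarith
    linarith
  have h3 : 0 ≤ z * f z ^ 2 := by positivity
  have h4 : 0 ≤ z * f₁ z ^ 2 := by positivity
  exact ⟨aux _ (by linarith), aux _ (by linarith)⟩

/-- A solution of the Bessel equation which is `O(1/z)` at the origin is controlled, together with
its derivative, on the whole half-line. -/
theorem SolvesBessel.exists_bound {f f₁ : ℝ → ℝ} (h : SolvesBessel f f₁) {A : ℝ}
    (hA : ∀ z : ℝ, 0 < z → z ≤ 1 → |f z| ≤ A / z) :
    ∃ C : ℝ, 0 < C ∧ ∀ z : ℝ, 0 < z →
      |f z| ≤ C * (1 / z + 1 / √z) ∧ |f₁ z| ≤ C * (1 / z + 1 / √z) := by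
  obtain ⟨C, hC, hdec⟩ := h.exists_decay
  have hA0 : 0 ≤ A := by simpa using (abs_nonneg _).trans (hA 1 one_pos le_rfl)
  have hone : ∀ z : ℝ, 0 < z → z ≤ 1 → |z * f₁ z| ≤ |f₁ 1| + A := by
    intro z hz hz1
    have := Convex.norm_image_sub_le_of_norm_hasDerivWithin_le (f := fun x => x * f₁ x)
      (f' := fun x => -(x * f x)) (s := Set.Ioc 0 1) (x := 1) (y := z) (C := A) ?_ ?_
      (convex_Ioc 0 1) ⟨one_pos, le_rfl⟩ ⟨hz, hz1⟩
    · simp only [Real.norm_eq_abs, one_mul] at this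
      have h1 : |z - 1| ≤ 1 := by rw [abs_le]; constructor <;> linarith
      have h2 : A * |z - 1| ≤ A := mul_le_of_le_one_right hA0 h1
      have h3 := abs_sub_abs_le_abs_sub (z * f₁ z) (f₁ 1)
      linarith
    · intro x hx
      have := (hasDerivAt_id x).mul (h x hx.1).2
      refine HasDerivAt.hasDerivWithinAt ?_
      refine this.congr_deriv ?_
      have := hx.1.ne'
      simp only [id]
      field_simp
      ring
    · intro x hx
      have := hA x hx.1 hx.2
      rw [le_div_iff₀ hx.1] at this
      rw [norm_neg, norm_mul, Real.norm_eq_abs, Real.norm_eq_abs, abs_of_pos hx.1]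
      linarith
  refine ⟨C + A + |f₁ 1|, by positivity, fun z hz => ?_⟩
  have hf1 := abs_nonneg (f₁ 1)
  have hz' : 0 < √z := Real.sqrt_pos.2 hz
  have p1 : 0 < 1 / z := by positivity
  have p2 : 0 < 1 / √z := by positivity
  rcases le_total z 1 with hz1 | hz1
  · have e1 := hA z hz hz1
    have e2 := hone z hz hz1
    rw [abs_mul, abs_of_pos hz, mul_comm, ← le_div_iff₀ hz] at e2
    rw [div_eq_mul_one_div] at e1 e2
    constructor <;> nlinarith [mul_pos hC p1, mul_nonneg hA0 p2.le, mul_nonneg hf1 p2.le,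
      mul_pos hC p2, mul_nonneg hA0 p1.le, mul_nonneg hf1 p1.le]
  · obtain ⟨e1, e2⟩ := hdec z hz1
    rw [div_eq_mul_one_div] at e1 e2
    constructor <;> nlinarith [mul_pos hC p1, mul_nonneg hA0 p2.le, mul_nonneg hf1 p2.le,
      mul_nonneg hA0 p1.le, mul_nonneg hf1 p1.le]

theorem exists_bound_J0 : ∃ C : ℝ, 0 < C ∧ ∀ z : ℝ, 0 < z →
    |J0 z| ≤ C / √(1 + z) ∧ |J0' z| ≤ C / √(1 + z) ∧ |J0' z| ≤ C * z / √(1 + z) := by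
  obtain ⟨C, hC, hdec⟩ := solvesBessel_J0.exists_decay
  refine ⟨2 * C + 2, by positivity, fun z hz => ?_⟩
  have hs : 0 < √(1 + z) := Real.sqrt_pos.2 (by linarith)
  rcases le_total z 1 with hz1 | hz1
  · have h2 : √(1 + z) ≤ 2 := by
      rw [Real.sqrt_le_left (by norm_num)]
      linarith
    have h0 := abs_J0_le_one z
    have h1 := abs_J0'_le hz.le
    refine ⟨?_, ?_, ?_⟩ <;> rw [le_div_iff₀ hs]
    · calc |J0 z| * √(1 + z) ≤ 1 * 2 := by gcongr
        _ ≤ _ := by linarith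
    · calc |J0' z| * √(1 + z) ≤ 1 * 2 := by gcongr; linarith
        _ ≤ _ := by linarith
    · calc |J0' z| * √(1 + z) ≤ z * 2 := by gcongr
        _ ≤ _ := by nlinarith
  · have h2 : √(1 + z) ≤ 2 * √z := by
      rw [Real.sqrt_le_left (by positivity), mul_pow, Real.sq_sqrt hz.le]
      linarith
    have hsz : 0 < √z := Real.sqrt_pos.2 hz
    obtain ⟨h0, h1⟩ := hdec z hz1
    rw [le_div_iff₀ hsz] at h0 h1
    have k0 : |J0 z| * √(1 + z) ≤ 2 * C + 2 := by
      nlinarith [mul_le_mul_of_nonneg_left h2 (abs_nonneg (J0 z))]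
    have k1 : |J0' z| * √(1 + z) ≤ 2 * C + 2 := by
      nlinarith [mul_le_mul_of_nonneg_left h2 (abs_nonneg (J0' z))]
    refine ⟨?_, ?_, ?_⟩ <;> rw [le_div_iff₀ hs]
    · exact k0
    · exact k1
    · nlinarith

theorem abs_integral_cos_mul_cosh_le {z T : ℝ} (hz : 0 < z) (hT : 1 ≤ T) :
    |∫ t in (0:ℝ)..T, Real.cos (z * Real.cosh t)| ≤ 1 + 2 / z := by
  have hs : ∀ t ∈ Set.uIcc 1 T, 0 < Real.sinh t := by
    intro t ht
    rw [Set.uIcc_of_le hT] at ht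
    exact Real.sinh_pos_iff.2 (by linarith [ht.1])
  have hcont : ContinuousOn (fun t => Real.sin (z * Real.cosh t) * Real.cosh t /
      (z * Real.sinh t ^ 2)) (Set.uIcc 1 T) := by
    refine ContinuousOn.div (by fun_prop) (by fun_prop) fun t ht => ?_
    have := hs t ht
    positivity
  have hcont' : ContinuousOn (fun t => Real.cosh t / (z * Real.sinh t ^ 2)) (Set.uIcc 1 T) := by
    refine ContinuousOn.div (by fun_prop) (by fun_prop) fun t ht => ?_
    have := hs t ht
    positivity
  have h1 : ∫ t in (1:ℝ)..T, (Real.cos (z * Real.cosh t) -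
      Real.sin (z * Real.cosh t) * Real.cosh t / (z * Real.sinh t ^ 2)) =
      Real.sin (z * Real.cosh T) / (z * Real.sinh T) -
        Real.sin (z * Real.cosh 1) / (z * Real.sinh 1) := by
    refine intervalIntegral.integral_eq_sub_of_hasDerivAt
      (f := fun t => Real.sin (z * Real.cosh t) / (z * Real.sinh t)) (fun t ht => ?_) ?_
    · have hst := hs t ht
      have := (((Real.hasDerivAt_cosh t).const_mul z).sin).div
        ((Real.hasDerivAt_sinh t).const_mul z) (by positivity)
      refine this.congr_deriv ?_
      field_simp
    · exact ((Continuous.continuousOn (by fun_prop)).sub hcont).intervalIntegrable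
  have h2 : ∫ t in (1:ℝ)..T, Real.cosh t / (z * Real.sinh t ^ 2) =
      -(1 / (z * Real.sinh T)) - -(1 / (z * Real.sinh 1)) := by
    refine intervalIntegral.integral_eq_sub_of_hasDerivAt
      (f := fun t => -(1 / (z * Real.sinh t))) (fun t ht => ?_) hcont'.intervalIntegrable
    have hst := hs t ht
    have := ((((Real.hasDerivAt_sinh t).const_mul z).inv (by positivity)).neg)
    simp only [one_div]
    refine this.congr_deriv ?_
    field_simp
  have h3 : ‖∫ t in (1:ℝ)..T, Real.sin (z * Real.cosh t) * Real.cosh t /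
      (z * Real.sinh t ^ 2)‖ ≤ ∫ t in (1:ℝ)..T, Real.cosh t / (z * Real.sinh t ^ 2) := by
    refine intervalIntegral.norm_integral_le_of_norm_le hT (ae_of_all volume fun t ht => ?_)
      hcont'.intervalIntegrable
    have hst := hs t (by rw [Set.uIcc_of_le hT]; exact Set.Ioc_subset_Icc_self ht)
    have hc := Real.cosh_pos t
    rw [Real.norm_eq_abs, abs_div, abs_mul, abs_of_pos hc,
      abs_of_pos (by positivity : 0 < z * Real.sinh t ^ 2)]
    gcongr
    exact mul_le_of_le_one_left hc.le (Real.abs_sin_le_one _)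
  have h4 : ‖∫ t in (0:ℝ)..1, Real.cos (z * Real.cosh t)‖ ≤ 1 * |1 - 0| :=
    intervalIntegral.norm_integral_le_of_norm_le_const fun t _ => Real.abs_cos_le_one _
  have hadd : (∫ t in (0:ℝ)..T, Real.cos (z * Real.cosh t)) =
      (∫ t in (0:ℝ)..1, Real.cos (z * Real.cosh t)) +
        ∫ t in (1:ℝ)..T, Real.cos (z * Real.cosh t) :=
    (intervalIntegral.integral_add_adjacent_intervals
      (Continuous.intervalIntegrable (by fun_prop) _ _)
      (Continuous.intervalIntegrable (by fun_prop) _ _)).symm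
  rw [intervalIntegral.integral_sub (Continuous.intervalIntegrable (by fun_prop) _ _)
    hcont.intervalIntegrable] at h1
  have hbd : ∀ t : ℝ, 0 < Real.sinh t → |Real.sin (z * Real.cosh t) / (z * Real.sinh t)| ≤
      1 / (z * Real.sinh t) := by
    intro t ht
    rw [abs_div, abs_of_pos (mul_pos hz ht)]
    gcongr
    exact Real.abs_sin_le_one _
  have b1 := hbd T (hs T Set.right_mem_uIcc)
  have b2 := hbd 1 (hs 1 Set.left_mem_uIcc)
  have b3 : 1 / (z * Real.sinh 1) ≤ 1 / z := by
    gcongr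
    exact le_mul_of_one_le_right hz.le (Real.self_le_sinh_iff.2 zero_le_one)
  rw [h2, Real.norm_eq_abs] at h3
  rw [Real.norm_eq_abs] at h4
  rw [abs_le] at *
  have : 2 / z = 1 / z + 1 / z := by ring
  norm_num at h4
  constructor <;> linarith [b1.1, b1.2, b2.1, b2.2, h3.1, h3.2, h4.1, h4.2]

/-- The truncated integrals satisfy the once-integrated Bessel equation up to an oscillating
boundary term. -/
theorem hasDerivAt_truncated (T z : ℝ) :
    HasDerivAt (fun z => z * (∫ t in (0:ℝ)..T, -(Real.cosh t * Real.sin (z * Real.cosh t))) -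
        Real.sinh T / Real.cosh T * Real.cos (z * Real.cosh T))
      (-(z * ∫ t in (0:ℝ)..T, Real.cos (z * Real.cosh t))) z := by
  have hs := hasDerivAt_integral_sin (k := Real.cosh) (h := Real.cosh) Real.continuous_cosh
    Real.continuous_cosh 0 T z
  have h1 := (hasDerivAt_id z).mul hs.neg
  have h2 := ((hasDerivAt_mul_const (x := z) (Real.cosh T)).cos).const_mul
    (Real.sinh T / Real.cosh T)
  have key : ∫ t in (0:ℝ)..T, (Real.cosh t * Real.sin (z * Real.cosh t) +
      z * (Real.cosh t * Real.cosh t * Real.cos (z * Real.cosh t)) -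
      z * Real.cos (z * Real.cosh t)) =
      Real.sinh T * Real.sin (z * Real.cosh T) - Real.sinh 0 * Real.sin (z * Real.cosh 0) := by
    refine intervalIntegral.integral_eq_sub_of_hasDerivAt
      (f := fun t => Real.sinh t * Real.sin (z * Real.cosh t)) (fun t _ => ?_)
      (Continuous.intervalIntegrable (by fun_prop) _ _)
    have := (Real.hasDerivAt_sinh t).mul (((Real.hasDerivAt_cosh t).const_mul z).sin)
    refine this.congr_deriv ?_
    linear_combination (-z * Real.cos (z * Real.cosh t)) * Real.cosh_sq t
  rw [intervalIntegral.integral_sub (Continuous.intervalIntegrable (by fun_prop) _ _)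
      (Continuous.intervalIntegrable (by fun_prop) _ _),
    intervalIntegral.integral_add (Continuous.intervalIntegrable (by fun_prop) _ _)
      (Continuous.intervalIntegrable (by fun_prop) _ _),
    intervalIntegral.integral_const_mul, intervalIntegral.integral_const_mul,
    Real.sinh_zero, zero_mul, sub_zero] at key
  simp only [intervalIntegral.integral_neg]
  refine (h1.sub h2).congr_deriv ?_
  have hc := (Real.cosh_pos T).ne'
  simp only [id, Pi.neg_apply]
  generalize (∫ t in (0:ℝ)..T, Real.cosh t * Real.sin (z * Real.cosh t)) = I₁ at key ⊢
  generalize (∫ t in (0:ℝ)..T, Real.cosh t * Real.cosh t * Real.cos (z * Real.cosh t)) = I₂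
    at key ⊢
  generalize (∫ t in (0:ℝ)..T, Real.cos (z * Real.cosh t)) = I₀ at key ⊢
  field_simp
  linear_combination -key

theorem continuous_integral_cos (T : ℝ) :
    Continuous fun z : ℝ => ∫ t in (0:ℝ)..T, Real.cos (z * Real.cosh t) := by
  have := fun z => (hasDerivAt_integral_cos (k := fun _ => 1) continuous_const
    Real.continuous_cosh 0 T z).continuousAt
  simpa only [one_mul] using continuous_iff_continuousAt.2 this

theorem uIcc_one_subset_Ioi {z : ℝ} (hz : 0 < z) : Set.uIcc 1 z ⊆ Set.Ioi 0 :=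
  fun _ hx => (lt_min one_pos hz).trans_le hx.1

/-- The twice-integrated Bessel equation for the truncated integrals, with an error which
vanishes as `T → ∞`. -/
theorem truncated_integral_equation (T : ℝ) {z : ℝ} (hz : 0 < z) :
    |((∫ t in (0:ℝ)..T, Real.cos (z * Real.cosh t)) -
        Real.sinh T / Real.cosh T * (Real.sin (z * Real.cosh T) / (Real.cosh T * z))) -
      ((∫ t in (0:ℝ)..T, Real.cos (1 * Real.cosh t)) -
        Real.sinh T / Real.cosh T * (Real.sin (1 * Real.cosh T) / (Real.cosh T * 1))) -
      (1 * (∫ t in (0:ℝ)..T, -(Real.cosh t * Real.sin (1 * Real.cosh t))) -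
        Real.sinh T / Real.cosh T * Real.cos (1 * Real.cosh T)) * Real.log z +
      ∫ x in (1:ℝ)..z, (∫ y in (1:ℝ)..x, y * ∫ t in (0:ℝ)..T, Real.cos (y * Real.cosh t)) / x|
      ≤ (1 + 1 / z ^ 2) * |z - 1| / Real.cosh T := by
  set th := Real.sinh T / Real.cosh T with hth
  set c := Real.cosh T with hc
  have hc0 : 0 < c := Real.cosh_pos T
  set F : ℝ → ℝ := fun z => ∫ t in (0:ℝ)..T, Real.cos (z * Real.cosh t) with hF
  set F₁ : ℝ → ℝ := fun z => ∫ t in (0:ℝ)..T, -(Real.cosh t * Real.sin (z * Real.cosh t))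
    with hF₁
  set G : ℝ → ℝ := fun z => z * F₁ z - th * Real.cos (z * c) with hG
  have hFc : Continuous F := continuous_integral_cos T
  have hFd : ∀ x, HasDerivAt F (F₁ x) x := by
    intro x
    have := hasDerivAt_integral_cos (k := fun _ => 1) continuous_const Real.continuous_cosh 0 T x
    simp only [one_mul] at this
    exact this
  have hGd : ∀ x, HasDerivAt G (-(x * F x)) x := hasDerivAt_truncated T
  have hth1 : |th| ≤ 1 := by
    rw [hth, abs_div, abs_of_pos hc0, div_le_one hc0, Real.abs_sinh, hc, ← Real.cosh_abs T]
    exact (Real.sinh_lt_cosh _).le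
  clear_value th c
  have hGc : Continuous G := continuous_iff_continuousAt.2 fun x => (hGd x).continuousAt
  have hQ : ∀ x, ∫ y in (1:ℝ)..x, y * F y = G 1 - G x := by
    intro x
    have := intervalIntegral.integral_eq_sub_of_hasDerivAt (a := 1) (b := x)
      (fun y _ => hGd y) (Continuous.intervalIntegrable (by fun_prop) _ _)
    rw [intervalIntegral.integral_neg] at this
    linarith
  have hpos := uIcc_one_subset_Ioi hz
  have hR : ∫ x in (1:ℝ)..z, (∫ y in (1:ℝ)..x, y * F y) / x =
      G 1 * Real.log z - ∫ x in (1:ℝ)..z, G x / x := by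
    have hi1 : IntervalIntegrable (fun x : ℝ => G 1 * (1 / x)) volume 1 z :=
      ContinuousOn.intervalIntegrable (ContinuousOn.mul continuousOn_const
        (continuousOn_const.div continuousOn_id fun x hx => (hpos hx).ne'))
    have hi2 : IntervalIntegrable (fun x : ℝ => G x / x) volume 1 z :=
      ContinuousOn.intervalIntegrable
        (hGc.continuousOn.div continuousOn_id fun x hx => (hpos hx).ne')
    have hlog : ∫ x in (1:ℝ)..z, 1 / x = Real.log z := by
      rw [integral_one_div_of_pos one_pos hz, div_one]
    rw [← hlog, ← intervalIntegral.integral_const_mul, ← intervalIntegral.integral_sub hi1 hi2]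
    refine intervalIntegral.integral_congr fun x _ => ?_
    simp only [hQ]
    ring
  have hcontE : ContinuousOn (fun x => th * (Real.sin (x * c) / (c * x ^ 2))) (Set.uIcc 1 z) := by
    refine continuousOn_const.mul (ContinuousOn.div (by fun_prop) (by fun_prop) fun x hx => ?_)
    have : 0 < x := hpos hx
    positivity
  have hcontG : ContinuousOn (fun x => G x / x) (Set.uIcc 1 z) :=
    hGc.continuousOn.div continuousOn_id fun x hx => (hpos hx).ne'
  have hH := intervalIntegral.integral_eq_sub_of_hasDerivAt (a := 1) (b := z)
    (f := fun x => F x - th * (Real.sin (x * c) / (c * x)))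
    (f' := fun x => G x / x + th * (Real.sin (x * c) / (c * x ^ 2)))
    (fun x hx => by
      have hx0 : 0 < x := hpos hx
      have h1 := ((hasDerivAt_mul_const (x := x) c).sin).div
        ((hasDerivAt_id x).const_mul c) (by simp only [id]; positivity)
      refine ((hFd x).sub (h1.const_mul th)).congr_deriv ?_
      simp only [id, hG]
      field_simp
      ring)
    (hcontG.add hcontE).intervalIntegrable
  rw [intervalIntegral.integral_add hcontG.intervalIntegrable hcontE.intervalIntegrable] at hH
  have hE : ‖∫ x in (1:ℝ)..z, th * (Real.sin (x * c) / (c * x ^ 2))‖ ≤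
      (1 + 1 / z ^ 2) / c * |z - 1| := by
    refine intervalIntegral.norm_integral_le_of_norm_le_const fun x hx => ?_
    have hx' := Set.uIoc_subset_uIcc hx
    have hx0 : 0 < x := hpos hx'
    have hxz : 1 / x ^ 2 ≤ 1 + 1 / z ^ 2 := by
      rcases le_total 1 z with h | h
      · rw [Set.uIcc_of_le h] at hx'
        have : 1 / x ^ 2 ≤ 1 := by
          rw [div_le_one (by positivity)]
          nlinarith [hx'.1]
        have : 0 < 1 / z ^ 2 := by positivity
        linarith
      · rw [Set.uIcc_of_ge h] at hx'
        have : 1 / x ^ 2 ≤ 1 / z ^ 2 := by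
          gcongr
          exact hx'.1
        linarith
    calc ‖th * (Real.sin (x * c) / (c * x ^ 2))‖
        = |th| * (|Real.sin (x * c)| * (1 / x ^ 2) / c) := by
          rw [Real.norm_eq_abs, abs_mul, abs_div, abs_of_pos (by positivity : 0 < c * x ^ 2)]
          field_simp
      _ ≤ 1 * (1 * (1 + 1 / z ^ 2) / c) := by
          gcongr
          exact Real.abs_sin_le_one _
      _ = _ := by ring
  rw [hR]
  change |(F z - th * (Real.sin (z * c) / (c * z))) - (F 1 - th * (Real.sin (1 * c) / (c * 1))) -
    G 1 * Real.log z + (G 1 * Real.log z - ∫ x in (1:ℝ)..z, G x / x)| ≤ _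
  rw [Real.norm_eq_abs] at hE
  refine le_of_eq_of_le (congrArg _ ?_) (hE.trans_eq (by ring))
  linear_combination -hH

/-- The limit of the truncated integrals solves the Bessel equation and is `O(1 / z)` at `0`. -/
theorem exists_solvesBessel_of_tendsto {Y : ℝ → ℝ}
    (hY : ∀ z : ℝ, 0 < z →
      Tendsto (fun T : ℝ => ∫ t in (0:ℝ)..T, Real.cos (z * Real.cosh t)) atTop (nhds (Y z))) :
    ∃ Y₁ : ℝ → ℝ, SolvesBessel Y Y₁ ∧ ∀ z : ℝ, 0 < z → |Y z| ≤ 1 + 2 / z := by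
  set F : ℝ → ℝ → ℝ := fun T z => ∫ t in (0:ℝ)..T, Real.cos (z * Real.cosh t) with hF
  have hFc : ∀ T, Continuous (F T) := continuous_integral_cos
  have hFb : ∀ z : ℝ, 0 < z → ∀ T : ℝ, 1 ≤ T → |F T z| ≤ 1 + 2 / z :=
    fun z hz T hT => abs_integral_cos_mul_cosh_le hz hT
  have hYb : ∀ z : ℝ, 0 < z → |Y z| ≤ 1 + 2 / z := fun z hz =>
    le_of_tendsto (hY z hz).abs ((eventually_ge_atTop 1).mono fun T hT => hFb z hz T hT)
  have hyF : ∀ y : ℝ, 0 < y → ∀ T : ℝ, 1 ≤ T → ‖y * F T y‖ ≤ y + 2 := by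
    intro y hy T hT
    rw [norm_mul, Real.norm_eq_abs, Real.norm_eq_abs, abs_of_pos hy]
    calc y * |F T y| ≤ y * (1 + 2 / y) := by gcongr; exact hFb y hy T hT
      _ = y + 2 := by field_simp
  have hyY : ∀ y : ℝ, 0 < y → ‖y * Y y‖ ≤ y + 2 := by
    intro y hy
    rw [norm_mul, Real.norm_eq_abs, Real.norm_eq_abs, abs_of_pos hy]
    calc y * |Y y| ≤ y * (1 + 2 / y) := by gcongr; exact hYb y hy
      _ = y + 2 := by field_simp
  have hint : ∀ a b : ℝ, 0 < a → 0 < b → IntervalIntegrable (fun y => y * Y y) volume a b := by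
    intro a b ha hb
    have hpos : ∀ y ∈ Set.uIoc a b, 0 < y := fun y hy => (lt_min ha hb).trans hy.1
    refine IntervalIntegrable.mono_fun' (g := fun y => y + 2)
      (Continuous.intervalIntegrable (by fun_prop) _ _) ?_ ?_
    · refine aestronglyMeasurable_of_tendsto_ae atTop (f := fun T y => y * F T y)
        (fun T => (continuous_id.mul (hFc T)).aestronglyMeasurable) ?_
      refine (ae_restrict_iff' measurableSet_uIoc).2 (ae_of_all _ fun y hy => ?_)
      exact (hY y (hpos y hy)).const_mul y
    · exact (ae_restrict_iff' measurableSet_uIoc).2 (ae_of_all _ fun y hy => hyY y (hpos y hy))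
  set Q : ℝ → ℝ := fun x => ∫ y in (1:ℝ)..x, y * Y y with hQ
  have hQc : ContinuousOn Q (Set.Ioi 0) := by
    intro x hx
    have hx0 : 0 < x := hx
    have h1 := intervalIntegral.continuousOn_primitive_interval' (a := 1)
      (hint (min 1 x / 2) (x + 1) (half_pos (lt_min one_pos hx0)) (by linarith)) ?_
    · refine (h1.continuousAt ?_).continuousWithinAt
      rw [Set.uIcc_of_le (by have := min_le_right 1 x; linarith)]
      exact Icc_mem_nhds (by have := min_le_right 1 x; linarith) (by linarith)
    · rw [Set.uIcc_of_le (by have := min_le_right 1 x; linarith)]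
      exact ⟨by have := min_le_left 1 x; linarith, by linarith⟩
  have hQT : ∀ x : ℝ, 0 < x → Tendsto (fun T => ∫ y in (1:ℝ)..x, y * F T y) atTop (nhds (Q x)) := by
    intro x hx
    refine intervalIntegral.tendsto_integral_filter_of_dominated_convergence (fun y => y + 2)
      (Eventually.of_forall fun T => (continuous_id.mul (hFc T)).aestronglyMeasurable) ?_
      (Continuous.intervalIntegrable (by fun_prop) _ _) ?_
    · refine (eventually_ge_atTop 1).mono fun T hT => ae_of_all _ fun y hy => ?_
      exact hyF y (uIcc_one_subset_Ioi hx (Set.uIoc_subset_uIcc hy)) T hT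
    · refine ae_of_all _ fun y hy => ?_
      exact (hY y (uIcc_one_subset_Ioi hx (Set.uIoc_subset_uIcc hy))).const_mul y
  have hQxc : ContinuousOn (fun x => Q x / x) (Set.Ioi 0) :=
    hQc.div continuousOn_id fun x hx => (Set.mem_Ioi.1 hx).ne'
  set R : ℝ → ℝ := fun z => ∫ x in (1:ℝ)..z, Q x / x with hR
  have hRT : ∀ z : ℝ, 0 < z →
      Tendsto (fun T => ∫ x in (1:ℝ)..z, (∫ y in (1:ℝ)..x, y * F T y) / x) atTop
        (nhds (R z)) := by
    intro z hz
    refine intervalIntegral.tendsto_integral_filter_of_dominated_convergence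
      (fun x => (z + 3) * (z + 1) / x) (Eventually.of_forall fun T => ?_) ?_ ?_ ?_
    · have hc : Continuous fun x => ∫ y in (1:ℝ)..x, y * F T y :=
        intervalIntegral.continuous_primitive
          (fun a b => (continuous_id.mul (hFc T)).intervalIntegrable a b) 1
      exact (hc.measurable.div measurable_id).aestronglyMeasurable
    · refine (eventually_ge_atTop 1).mono fun T hT => ae_of_all _ fun x hx => ?_
      have hx' := Set.uIoc_subset_uIcc hx
      have hx0 : 0 < x := uIcc_one_subset_Ioi hz hx'
      have hxz : x ≤ z + 1 := hx'.2.trans (max_le (by linarith) (by linarith))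
      have h1 : ‖∫ y in (1:ℝ)..x, y * F T y‖ ≤ (z + 3) * |x - 1| := by
        refine intervalIntegral.norm_integral_le_of_norm_le_const fun y hy => ?_
        have hy' := Set.uIoc_subset_uIcc hy
        have hyz : y ≤ z + 1 := hy'.2.trans (max_le (by linarith) hxz)
        exact (hyF y (uIcc_one_subset_Ioi hx0 hy') T hT).trans (by linarith)
      rw [norm_div, Real.norm_of_nonneg hx0.le]
      gcongr
      refine h1.trans ?_
      gcongr
      rw [abs_le]
      constructor <;> linarith
    · exact ContinuousOn.intervalIntegrable (continuousOn_const.div continuousOn_id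
        fun x hx => (Set.mem_Ioi.1 (uIcc_one_subset_Ioi hz hx)).ne')
    · refine ae_of_all _ fun x hx => ?_
      exact (hQT x (uIcc_one_subset_Ioi hz (Set.uIoc_subset_uIcc hx))).div_const x
  have hcosh : Tendsto Real.cosh atTop atTop :=
    tendsto_atTop_mono' atTop ((eventually_ge_atTop 0).mono fun x hx =>
      (Real.self_le_sinh_iff.2 hx).trans (Real.sinh_lt_cosh x).le) tendsto_id
  have hsmall : ∀ z : ℝ, 0 < z → Tendsto (fun T => Real.sinh T / Real.cosh T *
      (Real.sin (z * Real.cosh T) / (Real.cosh T * z))) atTop (nhds 0) := by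
    intro z hz
    have hlim : Tendsto (fun T => (1 / z) / Real.cosh T) atTop (nhds 0) :=
      hcosh.const_div_atTop (1 / z)
    refine squeeze_zero_norm (fun T => ?_) hlim
    have hc := Real.cosh_pos T
    have hth1 : |Real.sinh T / Real.cosh T| ≤ 1 := by
      rw [abs_div, abs_of_pos hc, div_le_one hc, Real.abs_sinh, ← Real.cosh_abs T]
      exact (Real.sinh_lt_cosh _).le
    rw [Real.norm_eq_abs, abs_mul, abs_div (Real.sin _), abs_of_pos (mul_pos hc hz)]
    calc |Real.sinh T / Real.cosh T| * (|Real.sin (z * Real.cosh T)| / (Real.cosh T * z))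
        ≤ 1 * (1 / (Real.cosh T * z)) := by
          gcongr
          exact Real.abs_sin_le_one _
      _ = _ := by field_simp
  set G : ℝ → ℝ := fun T => 1 * (∫ t in (0:ℝ)..T, -(Real.cosh t * Real.sin (1 * Real.cosh t))) -
    Real.sinh T / Real.cosh T * Real.cos (1 * Real.cosh T) with hG
  have hGT : ∀ z : ℝ, 0 < z →
      Tendsto (fun T => G T * Real.log z) atTop (nhds (Y z - Y 1 + R z)) := by
    intro z hz
    have herr := squeeze_zero_norm
      (fun T => (Real.norm_eq_abs _).trans_le (truncated_integral_equation T hz))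
      (hcosh.const_div_atTop _)
    have h1 := (((((hY z hz).sub (hsmall z hz)).sub
      ((hY 1 one_pos).sub (hsmall 1 one_pos))).add (hRT z hz)).sub herr)
    simp only [sub_zero] at h1
    refine h1.congr fun T => ?_
    simp only [hG, hF]
    ring
  have hlog2 : Real.log 2 ≠ 0 := (Real.log_pos one_lt_two).ne'
  obtain ⟨κ, hκ⟩ : ∃ κ, Tendsto G atTop (nhds κ) := by
    refine ⟨_, ((hGT 2 two_pos).div_const (Real.log 2)).congr fun T => ?_⟩
    field_simp
  have hYeq : ∀ z : ℝ, 0 < z → Y z = Y 1 + κ * Real.log z - R z := by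
    intro z hz
    have := tendsto_nhds_unique (hGT z hz) (hκ.mul_const (Real.log z))
    linarith
  have hRd : ∀ z : ℝ, 0 < z → HasDerivAt R (Q z / z) z := by
    intro z hz
    exact intervalIntegral.integral_hasDerivAt_right
      (hQxc.mono (uIcc_one_subset_Ioi hz)).intervalIntegrable
      (hQxc.stronglyMeasurableAtFilter isOpen_Ioi z hz)
      (hQxc.continuousAt (Ioi_mem_nhds hz))
  have hYd : ∀ z : ℝ, 0 < z → HasDerivAt Y ((κ - Q z) / z) z := by
    intro z hz
    have h1 := (((Real.hasDerivAt_log hz.ne').const_mul κ).const_add (Y 1)).sub (hRd z hz)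
    have h2 : Y =ᶠ[nhds z] fun z => Y 1 + κ * Real.log z - R z :=
      eventually_of_mem (Ioi_mem_nhds hz) hYeq
    refine (h1.congr_of_eventuallyEq h2).congr_deriv ?_
    field_simp
  have hyYc : ContinuousOn (fun y => y * Y y) (Set.Ioi 0) := fun z hz =>
    (continuousAt_id.mul (hYd z hz).continuousAt).continuousWithinAt
  have hQd : ∀ z : ℝ, 0 < z → HasDerivAt Q (z * Y z) z := by
    intro z hz
    exact intervalIntegral.integral_hasDerivAt_right (hint 1 z one_pos hz)
      (hyYc.stronglyMeasurableAtFilter isOpen_Ioi z hz)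
      (hyYc.continuousAt (Ioi_mem_nhds hz))
  refine ⟨fun z => (κ - Q z) / z, fun z hz => ⟨hYd z hz, ?_⟩, hYb⟩
  refine (((hQd z hz).const_sub κ).div (hasDerivAt_id z) hz.ne').congr_deriv ?_
  simp only [id]
  field_simp
  ring

/-- Differentiation formulas for the products of two rescaled solutions of the Bessel equation. -/
theorem SolvesBessel.hasDerivAt_products {f f₁ g g₁ : ℝ → ℝ} (hf : SolvesBessel f f₁)
    (hg : SolvesBessel g g₁) {r s l : ℝ} (hr : 0 < r) (hs : 0 < s) (hl : 0 < l) :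
    HasDerivAt (fun l => f (l * r) * g (l * s))
      (r * (f₁ (l * r) * g (l * s)) + s * (f (l * r) * g₁ (l * s))) l ∧
    HasDerivAt (fun l => f₁ (l * r) * g₁ (l * s))
      (-2 * (f₁ (l * r) * g₁ (l * s)) / l - r * (f (l * r) * g₁ (l * s)) -
        s * (f₁ (l * r) * g (l * s))) l ∧
    HasDerivAt (fun l => f₁ (l * r) * g (l * s))
      (-(f₁ (l * r) * g (l * s)) / l - r * (f (l * r) * g (l * s)) +
        s * (f₁ (l * r) * g₁ (l * s))) l ∧
    HasDerivAt (fun l => f (l * r) * g₁ (l * s))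
      (r * (f₁ (l * r) * g₁ (l * s)) - (f (l * r) * g₁ (l * s)) / l -
        s * (f (l * r) * g (l * s))) l := by
  obtain ⟨f0, f1⟩ := hf (l * r) (mul_pos hl hr)
  obtain ⟨g0, g1⟩ := hg (l * s) (mul_pos hl hs)
  have mr := hasDerivAt_mul_const (x := l) r
  have ms := hasDerivAt_mul_const (x := l) s
  have F0 : HasDerivAt (fun l => f (l * r)) (f₁ (l * r) * r) l := f0.comp l mr
  have F1 : HasDerivAt (fun l => f₁ (l * r)) _ l := f1.comp l mr
  have G0 : HasDerivAt (fun l => g (l * s)) (g₁ (l * s) * s) l := g0.comp l ms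
  have G1 : HasDerivAt (fun l => g₁ (l * s)) _ l := g1.comp l ms
  refine ⟨(F0.mul G0).congr_deriv ?_, (F1.mul G1).congr_deriv ?_, (F1.mul G0).congr_deriv ?_,
    (F0.mul G1).congr_deriv ?_⟩ <;> field_simp <;> ring

/-- A primitive of `besselIntegrand` with `φ = 1`, from Lommel-type identities. -/
noncomputable def lommelPrimitive (f f₁ g g₁ : ℝ → ℝ) (r s l : ℝ) : ℝ :=
  -(1 / (s * (r ^ 2 - s ^ 2))) *
      (l * (r * (f (l * r) * g₁ (l * s)) - s * (f₁ (l * r) * g (l * s)))) -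
    1 / (r ^ 2 - s ^ 2) *
      (l ^ 2 * (r * (f (l * r) * g (l * s)) + s * (f₁ (l * r) * g₁ (l * s)))) +
    2 * r / (r ^ 2 - s ^ 2) ^ 2 *
      (l * (s * (f (l * r) * g₁ (l * s)) - r * (f₁ (l * r) * g (l * s))))

/-- The boundary term of the integration by parts against the weight `w`. -/
noncomputable def lommelBoundary (f f₁ g g₁ w : ℝ → ℝ) (r s l : ℝ) : ℝ :=
  1 / (s * (r ^ 2 - s ^ 2) ^ 2) *
    ((2 * r * s * (f (l * r) * g (l * s)) +
      (r ^ 2 + s ^ 2) * (f₁ (l * r) * g₁ (l * s))) * (l * w l)) -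
  1 / (r ^ 2 - s ^ 2) ^ 2 *
    ((2 * r * s * (l * (f (l * r) * g₁ (l * s))) -
      (r ^ 2 + s ^ 2) * (l * (f₁ (l * r) * g (l * s)))) * (l * w l))

/-- The remainder term of the integration by parts against the weight `w`. -/
noncomputable def lommelRemainder (f f₁ g g₁ w w₁ : ℝ → ℝ) (r s l : ℝ) : ℝ :=
  2 * r / (r ^ 2 - s ^ 2) ^ 2 *
      (l * (s * (f (l * r) * g₁ (l * s)) - r * (f₁ (l * r) * g (l * s)))) * w l +
    1 / (r ^ 2 - s ^ 2) ^ 2 *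
      ((2 * r * s * (l * (f (l * r) * g₁ (l * s))) -
        (r ^ 2 + s ^ 2) * (l * (f₁ (l * r) * g (l * s)))) * (w l + l * w₁ l)) -
    1 / (s * (r ^ 2 - s ^ 2) ^ 2) *
      (-2 * (r ^ 2 + s ^ 2) * (f₁ (l * r) * g₁ (l * s)) * w l +
        (2 * r * s * (f (l * r) * g (l * s)) +
          (r ^ 2 + s ^ 2) * (f₁ (l * r) * g₁ (l * s))) * (w l + l * w₁ l))

theorem hasDerivAt_lommel {f f₁ g g₁ φ w w₁ : ℝ → ℝ} (hf : SolvesBessel f f₁)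
    (hg : SolvesBessel g g₁) (hφ : ∀ l, HasDerivAt φ (w l) l) (hw : ∀ l, HasDerivAt w (w₁ l) l)
    {r s l : ℝ} (hr : 0 < r) (hs : 0 < s) (hl : 0 < l) (hD : r ^ 2 - s ^ 2 ≠ 0) :
    HasDerivAt (fun l => lommelPrimitive f f₁ g g₁ r s l * φ l - lommelBoundary f f₁ g g₁ w r s l)
      (f₁ (l * r) * (-g₁ (l * s) / (l * s) - g (l * s)) * l ^ 2 * φ l +
        lommelRemainder f f₁ g g₁ w w₁ r s l) l := by
  obtain ⟨hA, hB, hP, hQ⟩ := hf.hasDerivAt_products hg hr hs hl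
  have hid := hasDerivAt_id l
  have hΦ := ((((hid.mul ((hQ.const_mul r).sub (hP.const_mul s))).const_mul
    (-(1 / (s * (r ^ 2 - s ^ 2))))).sub
    (((hid.pow 2).mul ((hA.const_mul r).add (hB.const_mul s))).const_mul
      (1 / (r ^ 2 - s ^ 2)))).add
    ((hid.mul ((hQ.const_mul s).sub (hP.const_mul r))).const_mul
      (2 * r / (r ^ 2 - s ^ 2) ^ 2)))
  have hΘ := (((((hA.const_mul (2 * r * s)).add (hB.const_mul (r ^ 2 + s ^ 2))).mul
    (hid.mul (hw l))).const_mul (1 / (s * (r ^ 2 - s ^ 2) ^ 2))).sub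
    (((((hid.mul hQ).const_mul (2 * r * s)).sub ((hid.mul hP).const_mul (r ^ 2 + s ^ 2))).mul
      (hid.mul (hw l))).const_mul (1 / (r ^ 2 - s ^ 2) ^ 2)))
  refine ((hΦ.mul (hφ l)).sub hΘ).congr_deriv ?_
  have hl' := hl.ne'
  have hs' := hs.ne'
  simp only [id, lommelRemainder, Pi.add_apply, Pi.sub_apply, Pi.mul_apply, Pi.pow_apply]
  generalize f (l * r) = U
  generalize f₁ (l * r) = U₁
  generalize g (l * s) = V
  generalize g₁ (l * s) = V₁
  generalize φ l = a
  generalize w l = b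
  generalize w₁ l = c
  generalize hDD : r ^ 2 - s ^ 2 = D at hD ⊢
  field_simp
  rw [← hDD]
  ring

theorem abs_lommelRemainder_le {f f₁ g g₁ w w₁ : ℝ → ℝ} {r s l N W : ℝ} (hr : 0 < r)
    (hs : 0 < s) (hl : 0 < l) (hl1 : l ≤ 1) (hrs : 1 ≤ |r - s|)
    (hA : |f (l * r) * g (l * s)| ≤ N) (hB : |f₁ (l * r) * g₁ (l * s)| ≤ s * N)
    (hP : |f₁ (l * r) * g (l * s)| ≤ N) (hQ : |f (l * r) * g₁ (l * s)| ≤ N)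
    (hw : |w l| ≤ W) (hw₁ : |w₁ l| ≤ W) :
    |lommelRemainder f f₁ g g₁ w w₁ r s l| ≤ 12 * N * W / (r - s) ^ 2 := by
  have hN : 0 ≤ N := (abs_nonneg _).trans hA
  have hW : 0 ≤ W := (abs_nonneg _).trans hw
  have hm : r - s ≠ 0 := fun h => by simp [h] at hrs; linarith
  have hS : 1 ≤ r + s := by
    rcases le_abs.1 hrs with h | h <;> linarith
  rw [lommelRemainder]
  generalize f (l * r) * g (l * s) = A at *
  generalize f₁ (l * r) * g (l * s) = P at *
  generalize f (l * r) * g₁ (l * s) = Q at *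
  obtain ⟨B, hB'⟩ : ∃ B, f₁ (l * r) * g₁ (l * s) = s * B :=
    ⟨f₁ (l * r) * g₁ (l * s) / s, by field_simp⟩
  rw [hB', abs_mul, abs_of_pos hs] at hB
  have hB := le_of_mul_le_mul_left hB hs
  rw [hB']
  generalize w l = b at *
  have hc : |b + l * w₁ l| ≤ 2 * W := by
    refine (abs_add_le _ _).trans ?_
    rw [abs_mul, abs_of_pos hl]
    nlinarith [abs_nonneg (w₁ l)]
  generalize b + l * w₁ l = c at *
  have hD : (r ^ 2 - s ^ 2) ≠ 0 := by
    rw [sq_sub_sq]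
    exact mul_ne_zero (by linarith) hm
  have hlQ : |l * Q| ≤ N := by
    rw [abs_mul, abs_of_pos hl]
    nlinarith [abs_nonneg Q]
  have hlP : |l * P| ≤ N := by
    rw [abs_mul, abs_of_pos hl]
    nlinarith [abs_nonneg P]
  have expand : 2 * r / (r ^ 2 - s ^ 2) ^ 2 * (l * (s * Q - r * P)) * b +
      1 / (r ^ 2 - s ^ 2) ^ 2 * ((2 * r * s * (l * Q) - (r ^ 2 + s ^ 2) * (l * P)) * c) -
      1 / (s * (r ^ 2 - s ^ 2) ^ 2) * (-2 * (r ^ 2 + s ^ 2) * (s * B) * b +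
        (2 * r * s * A + (r ^ 2 + s ^ 2) * (s * B)) * c) =
      (2 * r * s * ((l * Q) * b) - 2 * r ^ 2 * ((l * P) * b) + 2 * r * s * ((l * Q) * c) -
        (r ^ 2 + s ^ 2) * ((l * P) * c) + 2 * (r ^ 2 + s ^ 2) * (B * b) - 2 * r * (A * c) -
        (r ^ 2 + s ^ 2) * (B * c)) / (r ^ 2 - s ^ 2) ^ 2 := by
    field_simp
    ring
  have hprod : ∀ x y M : ℝ, |x| ≤ N → |y| ≤ M → |x * y| ≤ N * M := by
    intro x y M hx hy
    rw [abs_mul]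
    exact mul_le_mul hx hy (abs_nonneg _) hN
  have e1 := abs_le.1 (hprod _ _ _ hlQ hw)
  have e2 := abs_le.1 (hprod _ _ _ hlP hw)
  have e3 := abs_le.1 (hprod _ _ _ hlQ hc)
  have e4 := abs_le.1 (hprod _ _ _ hlP hc)
  have e5 := abs_le.1 (hprod _ _ _ hB hw)
  have e6 := abs_le.1 (hprod _ _ _ hA hc)
  have e7 := abs_le.1 (hprod _ _ _ hB hc)
  have c1 : 0 ≤ 2 * r * s := by positivity
  have c2 : 0 ≤ 2 * r ^ 2 := by positivity
  have c3 : 0 ≤ r ^ 2 + s ^ 2 := by positivity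
  have c4 : 0 ≤ 2 * r := by positivity
  have hNW : 0 ≤ N * W := mul_nonneg hN hW
  have htot : (2 * r * s + 2 * r ^ 2 + 2 * (2 * r * s) + 2 * (r ^ 2 + s ^ 2) +
      2 * (r ^ 2 + s ^ 2) + 2 * (2 * r) + 2 * (r ^ 2 + s ^ 2)) * (N * W) ≤
      12 * (r + s) ^ 2 * (N * W) := by
    gcongr
    nlinarith [mul_pos hr hs]
  rw [expand, abs_div, abs_of_nonneg (sq_nonneg (r ^ 2 - s ^ 2))]
  have hD2 : (r ^ 2 - s ^ 2) ^ 2 = (r + s) ^ 2 * (r - s) ^ 2 := by ring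
  rw [div_le_div_iff₀ (by positivity) (by positivity), hD2]
  have hm2 : 0 ≤ (r - s) ^ 2 := sq_nonneg _
  suffices h : |2 * r * s * ((l * Q) * b) - 2 * r ^ 2 * ((l * P) * b) +
      2 * r * s * ((l * Q) * c) - (r ^ 2 + s ^ 2) * ((l * P) * c) +
      2 * (r ^ 2 + s ^ 2) * (B * b) - 2 * r * (A * c) - (r ^ 2 + s ^ 2) * (B * c)| ≤
      12 * (r + s) ^ 2 * (N * W) by
    calc _ ≤ 12 * (r + s) ^ 2 * (N * W) * (r - s) ^ 2 := by gcongr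
      _ = _ := by ring
  have E1 := mul_le_mul_of_nonneg_left e1.1 c1
  have E1' := mul_le_mul_of_nonneg_left e1.2 c1
  have E2 := mul_le_mul_of_nonneg_left e2.1 c2
  have E2' := mul_le_mul_of_nonneg_left e2.2 c2
  have E3 := mul_le_mul_of_nonneg_left e3.1 c1
  have E3' := mul_le_mul_of_nonneg_left e3.2 c1
  have E4 := mul_le_mul_of_nonneg_left e4.1 c3
  have E4' := mul_le_mul_of_nonneg_left e4.2 c3
  have E5 := mul_le_mul_of_nonneg_left e5.1 c3
  have E5' := mul_le_mul_of_nonneg_left e5.2 c3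
  have E6 := mul_le_mul_of_nonneg_left e6.1 c4
  have E6' := mul_le_mul_of_nonneg_left e6.2 c4
  have E7 := mul_le_mul_of_nonneg_left e7.1 c3
  have E7' := mul_le_mul_of_nonneg_left e7.2 c3
  rw [abs_le]
  constructor <;> nlinarith only [E1, E1', E2, E2', E3, E3', E4, E4', E5, E5', E6, E6', E7, E7',
    htot]

theorem singular_weight_scale {l r : ℝ} (hl : 0 < l) (hl1 : l ≤ 1) (hr : 0 < r) :
    1 / (l * r) + 1 / √(l * r) ≤ 1 / l * (1 / r + 1 / √r) := by
  have h1 : l ≤ √l := Real.le_sqrt_of_sq_le (by nlinarith)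
  rw [Real.sqrt_mul hl.le, mul_add, one_div_mul_one_div, one_div_mul_one_div]
  gcongr

theorem decay_weight_scale {l s : ℝ} (hl : 0 < l) (hl1 : l ≤ 1) (hs : 0 < s) :
    1 / √(1 + l * s) ≤ 1 / l * (1 / √(1 + s)) := by
  rw [one_div_mul_one_div]
  have h : l * √(1 + s) ≤ √(1 + l * s) := by
    refine Real.le_sqrt_of_sq_le ?_
    rw [mul_pow, Real.sq_sqrt (by positivity)]
    nlinarith [mul_pos hl hs]
  gcongr

/-- The integrand with factors `f₁ (l r)`, `l²`, `φ l` and the second derivative of `g` at `l s`,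
the latter being expressed by the Bessel equation. -/
noncomputable def besselIntegrand (f₁ g g₁ φ : ℝ → ℝ) (r s l : ℝ) : ℝ :=
  f₁ (l * r) * (-g₁ (l * s) / (l * s) - g (l * s)) * l ^ 2 * φ l

theorem abs_besselIntegrand_le {f₁ g g₁ φ : ℝ → ℝ} {C K : ℝ}
    (hf₁ : ∀ z : ℝ, 0 < z → |f₁ z| ≤ C * (1 / z + 1 / √z))
    (hg : ∀ z : ℝ, 0 < z → |g z| ≤ K / √(1 + z))
    (hg₁ : ∀ z : ℝ, 0 < z → |g₁ z| ≤ K * z / √(1 + z))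
    (hφ : ∀ l, φ l ∈ Set.Icc (0:ℝ) 1) {r s l : ℝ} (hr : 0 < r) (hs : 0 < s) (hl : 0 < l)
    (hl1 : l ≤ 1) :
    |besselIntegrand f₁ g g₁ φ r s l| ≤ 2 * C * K * ((1 / r + 1 / √r) * (1 / √(1 + s))) := by
  have hlr := mul_pos hl hr
  have hls := mul_pos hl hs
  have p1 : 0 < 1 / r + 1 / √r := by positivity
  have p2 : 0 < 1 / √(1 + s) := by positivity
  have hC : 0 ≤ C := by
    have := (abs_nonneg _).trans (hf₁ 1 one_pos)
    norm_num at this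
    linarith
  have hK : 0 ≤ K := by
    have := (abs_nonneg _).trans (hg 1 one_pos)
    rwa [le_div_iff₀ (by positivity), zero_mul] at this
  have h1 : |f₁ (l * r)| ≤ C * (1 / l * (1 / r + 1 / √r)) :=
    (hf₁ _ hlr).trans (by gcongr; exact singular_weight_scale hl hl1 hr)
  have h2 : |-g₁ (l * s) / (l * s) - g (l * s)| ≤ 2 * (K * (1 / l * (1 / √(1 + s)))) := by
    have e1 : |-g₁ (l * s) / (l * s)| ≤ K / √(1 + l * s) := by
      rw [abs_div, abs_neg, abs_of_pos hls, div_le_iff₀ hls]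
      exact (hg₁ _ hls).trans_eq (by ring)
    have e2 : K / √(1 + l * s) ≤ K * (1 / l * (1 / √(1 + s))) := by
      rw [div_eq_mul_one_div]
      gcongr
      exact decay_weight_scale hl hl1 hs
    have e3 := hg _ hls
    have e4 := abs_sub (-g₁ (l * s) / (l * s)) (g (l * s))
    linarith
  have h3 : |φ l| ≤ 1 := by
    rw [abs_le]
    exact ⟨by linarith [(hφ l).1], (hφ l).2⟩
  rw [besselIntegrand, abs_mul, abs_mul, abs_mul, abs_of_pos (by positivity : 0 < l ^ 2)]
  calc _ ≤ C * (1 / l * (1 / r + 1 / √r)) * (2 * (K * (1 / l * (1 / √(1 + s))))) * l ^ 2 * 1 := by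
        gcongr
    _ = _ := by field_simp

theorem SolvesBessel.continuousOn_comp {f f₁ : ℝ → ℝ} (h : SolvesBessel f f₁) {r : ℝ}
    (hr : 0 < r) : ContinuousOn (fun l => f (l * r)) (Set.Ioi 0) ∧
      ContinuousOn (fun l => f₁ (l * r)) (Set.Ioi 0) := by
  have hm : ContinuousOn (fun l : ℝ => l * r) (Set.Ioi 0) := by fun_prop
  have hmaps : Set.MapsTo (fun l : ℝ => l * r) (Set.Ioi 0) (Set.Ioi 0) :=
    fun l hl => mul_pos hl hr
  refine ⟨ContinuousOn.comp (g := f) (t := Set.Ioi 0) ?_ hm hmaps,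
    ContinuousOn.comp (g := f₁) (t := Set.Ioi 0) ?_ hm hmaps⟩
  · exact fun z hz => (h z hz).1.continuousAt.continuousWithinAt
  · exact fun z hz => (h z hz).2.continuousAt.continuousWithinAt

theorem continuousOn_besselIntegrand {f f₁ g g₁ φ : ℝ → ℝ} (hf : SolvesBessel f f₁)
    (hg : SolvesBessel g g₁) (hφ : Continuous φ) {r s : ℝ} (hr : 0 < r) (hs : 0 < s) :
    ContinuousOn (besselIntegrand f₁ g g₁ φ r s) (Set.Ioi 0) := by
  have h1 := (hf.continuousOn_comp hr).2
  obtain ⟨h2, h3⟩ := hg.continuousOn_comp hs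
  exact ((h1.mul ((h3.neg.div (by fun_prop) fun l hl => (mul_pos hl hs).ne').sub h2)).mul
    (by fun_prop)).mul hφ.continuousOn

theorem continuousOn_lommelRemainder {f f₁ g g₁ w w₁ : ℝ → ℝ} (hf : SolvesBessel f f₁)
    (hg : SolvesBessel g g₁) (hw : Continuous w) (hw₁ : Continuous w₁) {r s : ℝ} (hr : 0 < r)
    (hs : 0 < s) : ContinuousOn (lommelRemainder f f₁ g g₁ w w₁ r s) (Set.Ioi 0) := by
  obtain ⟨h1, h2⟩ := hf.continuousOn_comp hr
  obtain ⟨h3, h4⟩ := hg.continuousOn_comp hs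
  have hid : ContinuousOn (fun l : ℝ => l) (Set.Ioi 0) := continuousOn_id
  have hc : ∀ k : ℝ, ContinuousOn (fun _ : ℝ => k) (Set.Ioi 0) := fun k => continuousOn_const
  have hww := hw.continuousOn (s := Set.Ioi 0)
  have hv := hww.add (hid.mul (hw₁.continuousOn (s := Set.Ioi 0)))
  have hA := h1.mul h3
  have hQ := h1.mul h4
  have hP := h2.mul h3
  have hB := h2.mul h4
  exact (((((hc _).mul (hid.mul (((hc _).mul hQ).sub ((hc _).mul hP)))).mul hww).add
    ((hc _).mul ((((hc _).mul (hid.mul hQ)).sub ((hc _).mul (hid.mul hP))).mul hv))).sub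
    ((hc _).mul ((((hc _).mul hB).mul hww).add ((((hc _).mul hA).add ((hc _).mul hB)).mul hv))))

theorem integral_besselIntegrand_eq {f₁ g g₁ φ : ℝ → ℝ} {b : ℝ} (hb : 0 ≤ b)
    (hφ0 : ∀ l, b ≤ l → φ l = 0) (r s : ℝ) :
    ∫ l in Set.Ioi (0:ℝ), besselIntegrand f₁ g g₁ φ r s l =
      ∫ l in (0:ℝ)..b, besselIntegrand f₁ g g₁ φ r s l := by
  rw [intervalIntegral.integral_of_le hb]
  refine setIntegral_eq_of_subset_of_forall_sdiff_eq_zero measurableSet_Ioi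
    Set.Ioc_subset_Ioi_self fun l hl => ?_
  have : b ≤ l := by
    by_contra h
    exact hl.2 ⟨hl.1, (not_le.1 h).le⟩
  simp [besselIntegrand, hφ0 l this]

theorem integrableOn_besselIntegrand {f f₁ g g₁ φ : ℝ → ℝ} {C K b : ℝ} (hf : SolvesBessel f f₁)
    (hg : SolvesBessel g g₁) (hφc : Continuous φ)
    (hf₁b : ∀ z : ℝ, 0 < z → |f₁ z| ≤ C * (1 / z + 1 / √z))
    (hgb : ∀ z : ℝ, 0 < z → |g z| ≤ K / √(1 + z))
    (hg₁b : ∀ z : ℝ, 0 < z → |g₁ z| ≤ K * z / √(1 + z))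
    (hφ : ∀ l, φ l ∈ Set.Icc (0:ℝ) 1) (hb1 : b ≤ 1)
    (hφ0 : ∀ l, b ≤ l → φ l = 0) {r s : ℝ} (hr : 0 < r) (hs : 0 < s) :
    IntegrableOn (besselIntegrand f₁ g g₁ φ r s) (Set.Ioi 0) := by
  have h1 : IntegrableOn (besselIntegrand f₁ g g₁ φ r s) (Set.Ioc 0 1) := by
    refine Integrable.of_bound (C := 2 * C * K * ((1 / r + 1 / √r) * (1 / √(1 + s)))) ?_ ?_
    · exact ((continuousOn_besselIntegrand hf hg hφc hr hs).mono
        Set.Ioc_subset_Ioi_self).aestronglyMeasurable measurableSet_Ioc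
    · exact (ae_restrict_iff' measurableSet_Ioc).2 (ae_of_all _ fun l hl =>
        abs_besselIntegrand_le hf₁b hgb hg₁b hφ hr hs hl.1 hl.2)
  refine h1.of_forall_sdiff_eq_zero measurableSet_Ioi fun l hl => ?_
  have : b ≤ l := by
    by_contra h
    exact hl.2 ⟨hl.1, (not_le.1 h).le.trans hb1⟩
  simp [besselIntegrand, hφ0 l this]

theorem abs_lommelPrimitive_le {f f₁ g g₁ : ℝ → ℝ} {C K : ℝ}
    (hfb : ∀ z : ℝ, 0 < z → |f z| ≤ C * (1 / z + 1 / √z) ∧ |f₁ z| ≤ C * (1 / z + 1 / √z))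
    (hgb : ∀ z : ℝ, 0 < z →
      |g z| ≤ K / √(1 + z) ∧ |g₁ z| ≤ K / √(1 + z) ∧ |g₁ z| ≤ K * z / √(1 + z))
    {r s : ℝ} (hr : 0 < r) (hs : 0 < s) (hD : r ^ 2 - s ^ 2 ≠ 0) :
    ∃ L : ℝ, ∀ l : ℝ, 0 < l → l ≤ 1 → l * r ≤ 1 → |lommelPrimitive f f₁ g g₁ r s l| ≤
      2 * C * K * ((r ^ 2 + s ^ 2) / (r * (r ^ 2 - s ^ 2) ^ 2)) + L * l := by
  have hC : 0 ≤ C := by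
    have := (abs_nonneg _).trans (hfb 1 one_pos).1
    norm_num at this
    linarith
  have hK : 0 ≤ K := by
    have := (abs_nonneg _).trans (hgb 1 one_pos).1
    rwa [le_div_iff₀ (by positivity), zero_mul] at this
  set a := -(1 / (s * (r ^ 2 - s ^ 2))) * r + 2 * r / (r ^ 2 - s ^ 2) ^ 2 * s with ha
  set b := 1 / (r ^ 2 - s ^ 2) with hb
  set M := 2 * C * K / r with hM
  have hM0 : 0 ≤ M := by positivity
  refine ⟨|a| * (s * M) + |b| * (r * M + s * M), fun l hl hl1 hlr1 => ?_⟩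
  have hlr := mul_pos hl hr
  have hls := mul_pos hl hs
  have hsing : C * (1 / (l * r) + 1 / √(l * r)) ≤ 2 * C / (l * r) := by
    have : 1 / √(l * r) ≤ 1 / (l * r) := by
      gcongr
      exact Real.le_sqrt_of_sq_le (by nlinarith)
    calc C * (1 / (l * r) + 1 / √(l * r)) ≤ C * (1 / (l * r) + 1 / (l * r)) := by gcongr
      _ = _ := by ring
  have f0 := (hfb _ hlr).1.trans hsing
  have f1 := (hfb _ hlr).2.trans hsing
  obtain ⟨g0, g1, g1'⟩ := hgb _ hls
  have hsq : 1 ≤ √(1 + l * s) := Real.one_le_sqrt.2 (by linarith)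
  have g0 := g0.trans (div_le_self hK hsq)
  have g1 := g1.trans (div_le_self hK hsq)
  have g1' := g1'.trans (div_le_self (by positivity) hsq)
  have hprod : ∀ x y k : ℝ, |x| ≤ 2 * C / (l * r) → |y| ≤ k → |l * (x * y)| ≤ 2 * C / r * k := by
    intro x y k hx hy
    rw [abs_mul, abs_mul, abs_of_pos hl]
    calc l * (|x| * |y|) ≤ l * (2 * C / (l * r) * k) := by gcongr
      _ = _ := by field_simp
  have eP := hprod _ _ _ f1 g0
  have eQ := hprod _ _ _ f0 g1'
  have eA := hprod _ _ _ f0 g0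
  have eB := hprod _ _ _ f1 g1
  rw [lommelPrimitive]
  generalize f (l * r) * g (l * s) = A at *
  generalize f₁ (l * r) * g (l * s) = P at *
  generalize f (l * r) * g₁ (l * s) = Q at *
  generalize f₁ (l * r) * g₁ (l * s) = B at *
  have e : -(1 / (s * (r ^ 2 - s ^ 2))) * (l * (r * Q - s * P)) -
      1 / (r ^ 2 - s ^ 2) * (l ^ 2 * (r * A + s * B)) +
      2 * r / (r ^ 2 - s ^ 2) ^ 2 * (l * (s * Q - r * P)) =
      -((r ^ 2 + s ^ 2) / (r ^ 2 - s ^ 2) ^ 2 * (l * P)) + a * (l * Q) -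
        b * (l * (r * (l * A) + s * (l * B))) := by
    rw [ha, hb]
    field_simp
    ring
  rw [e]
  have t1 : |(r ^ 2 + s ^ 2) / (r ^ 2 - s ^ 2) ^ 2 * (l * P)| ≤
      2 * C * K * ((r ^ 2 + s ^ 2) / (r * (r ^ 2 - s ^ 2) ^ 2)) := by
    rw [abs_mul, abs_of_nonneg (by positivity : 0 ≤ (r ^ 2 + s ^ 2) / (r ^ 2 - s ^ 2) ^ 2)]
    calc _ ≤ (r ^ 2 + s ^ 2) / (r ^ 2 - s ^ 2) ^ 2 * (2 * C / r * K) := by gcongr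
      _ = _ := by field_simp
  have t2 : |a * (l * Q)| ≤ |a| * (s * M) * l := by
    rw [abs_mul]
    calc |a| * |l * Q| ≤ |a| * (2 * C / r * (K * (l * s))) := by gcongr
      _ = _ := by rw [hM]; ring
  have t3 : |b * (l * (r * (l * A) + s * (l * B)))| ≤ |b| * (r * M + s * M) * l := by
    rw [abs_mul, abs_mul, abs_of_pos hl]
    have : |r * (l * A) + s * (l * B)| ≤ r * M + s * M := by
      refine (abs_add_le _ _).trans ?_
      rw [abs_mul r, abs_mul s, abs_of_pos hs, abs_of_pos hr]
      have hM' : 2 * C / r * K = M := by rw [hM]; ring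
      rw [hM'] at eA eB
      gcongr
    calc |b| * (l * |r * (l * A) + s * (l * B)|) ≤ |b| * (l * (r * M + s * M)) := by gcongr
      _ = _ := by ring
  rw [abs_le] at *
  constructor <;> nlinarith only [t1.1, t1.2, t2.1, t2.2, t3.1, t3.2]

/-- Off-diagonal estimate for the integral with smooth cutoff. -/
theorem abs_integral_besselIntegrand_le_of_one_le {f f₁ g g₁ φ w w₁ : ℝ → ℝ} {C K W κ b : ℝ}
    (hf : SolvesBessel f f₁) (hg : SolvesBessel g g₁)
    (hfb : ∀ z : ℝ, 0 < z → |f z| ≤ C * (1 / z + 1 / √z) ∧ |f₁ z| ≤ C * (1 / z + 1 / √z))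
    (hgb : ∀ z : ℝ, 0 < z →
      |g z| ≤ K / √(1 + z) ∧ |g₁ z| ≤ K / √(1 + z) ∧ |g₁ z| ≤ K * z / √(1 + z))
    (hφd : ∀ l, HasDerivAt φ (w l) l) (hwd : ∀ l, HasDerivAt w (w₁ l) l) (hw₁c : Continuous w₁)
    (hφ : ∀ l, φ l ∈ Set.Icc (0:ℝ) 1) (hκ : 0 < κ) (hκb : κ ≤ b) (hb1 : b ≤ 1)
    (hφ0 : ∀ l, b ≤ l → φ l = 0) (hφ1 : ∀ l, 0 < l → l < κ → φ l = 1)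
    (hw0 : ∀ l, 0 < l → l < κ → w l = 0) (hw₁0 : ∀ l, 0 < l → l < κ → w₁ l = 0)
    (hwb : w b = 0) (hW : ∀ l ∈ Set.Icc (0:ℝ) 1, |w l| ≤ W ∧ |w₁ l| ≤ W)
    {r s : ℝ} (hr : 0 < r) (hs : 0 < s) (hrs : 1 ≤ |r - s|) :
    |∫ l in Set.Ioi (0:ℝ), besselIntegrand f₁ g g₁ φ r s l| ≤
      2 * C * K * ((r ^ 2 + s ^ 2) / (r * (r ^ 2 - s ^ 2) ^ 2)) +
        12 * (C * K / κ ^ 2 * ((1 / r + 1 / √r) * (1 / √(1 + s)))) * W / (r - s) ^ 2 := by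
  have hb0 : 0 < b := hκ.trans_le hκb
  have hm : r - s ≠ 0 := fun h => by simp [h] at hrs; linarith
  have hD : r ^ 2 - s ^ 2 ≠ 0 := by
    rw [sq_sub_sq]
    exact mul_ne_zero (by linarith) hm
  have hC : 0 ≤ C := by
    have := (abs_nonneg _).trans (hfb 1 one_pos).1
    norm_num at this
    linarith
  have hK : 0 ≤ K := by
    have := (abs_nonneg _).trans (hgb 1 one_pos).1
    rwa [le_div_iff₀ (by positivity), zero_mul] at this
  have hW0 : 0 ≤ W := (abs_nonneg _).trans (hW 0 (by simp)).1
  have hφc : Continuous φ := continuous_iff_continuousAt.2 fun l => (hφd l).continuousAt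
  have hwc : Continuous w := continuous_iff_continuousAt.2 fun l => (hwd l).continuousAt
  set X := (1 / r + 1 / √r) * (1 / √(1 + s)) with hX
  have hX0 : 0 ≤ X := by positivity
  set N := C * K / κ ^ 2 * X with hN
  set B := 12 * N * W / (r - s) ^ 2 with hB
  have hB0 : 0 ≤ B := by positivity
  have hRb : ∀ l : ℝ, 0 < l → l ≤ 1 → |lommelRemainder f f₁ g g₁ w w₁ r s l| ≤ B := by
    intro l hl hl1
    rcases lt_or_ge l κ with hlκ | hlκ
    · rw [lommelRemainder, hw0 l hl hlκ, hw₁0 l hl hlκ]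
      simpa using hB0
    · have hlr := mul_pos hl hr
      have hls := mul_pos hl hs
      have hinv : 1 / l ≤ 1 / κ := by gcongr
      have s1 : 1 / (l * r) + 1 / √(l * r) ≤ 1 / κ * (1 / r + 1 / √r) :=
        (singular_weight_scale hl hl1 hr).trans (by gcongr)
      have s2 : 1 / √(1 + l * s) ≤ 1 / κ * (1 / √(1 + s)) :=
        (decay_weight_scale hl hl1 hs).trans (by gcongr)
      have f0 := (hfb _ hlr).1.trans (mul_le_mul_of_nonneg_left s1 hC)
      have f1 := (hfb _ hlr).2.trans (mul_le_mul_of_nonneg_left s1 hC)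
      obtain ⟨g0, g1, g1'⟩ := hgb _ hls
      rw [div_eq_mul_one_div] at g0 g1 g1'
      have g0 := g0.trans (mul_le_mul_of_nonneg_left s2 hK)
      have g1 := g1.trans (mul_le_mul_of_nonneg_left s2 hK)
      have g1' : |g₁ (l * s)| ≤ s * (K * (1 / κ * (1 / √(1 + s)))) := by
        refine g1'.trans ((mul_le_mul_of_nonneg_left s2 (by positivity)).trans ?_)
        have hq : 0 ≤ s * (K * (1 / κ * (1 / √(1 + s)))) := by positivity
        calc K * (l * s) * (1 / κ * (1 / √(1 + s))) = l * (s * (K * (1 / κ * (1 / √(1 + s))))) := by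
              ring
          _ ≤ _ := mul_le_of_le_one_left hq hl1
      have hprod : ∀ x y k : ℝ, |x| ≤ C * (1 / κ * (1 / r + 1 / √r)) →
          |y| ≤ k * (K * (1 / κ * (1 / √(1 + s)))) → |x * y| ≤ k * N := by
        intro x y k hx hy
        rw [abs_mul]
        calc |x| * |y| ≤ C * (1 / κ * (1 / r + 1 / √r)) *
              (k * (K * (1 / κ * (1 / √(1 + s))))) := by gcongr
          _ = k * N := by rw [hN, hX]; field_simp
      have hWl := hW l ⟨hl.le, hl1⟩
      rw [← one_mul (K * _)] at g0 g1
      have eA := hprod _ _ _ f0 g0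
      have eP := hprod _ _ _ f1 g0
      have eQ := hprod _ _ _ f0 g1
      have eB := hprod _ _ _ f1 g1'
      rw [one_mul] at eA eP eQ
      exact abs_lommelRemainder_le hr hs hl hl1 hrs eA eB eP eQ hWl.1 hWl.2
  obtain ⟨L, hL⟩ := abs_lommelPrimitive_le hfb hgb hr hs hD
  have hi : IntegrableOn (besselIntegrand f₁ g g₁ φ r s) (Set.Ioi 0) :=
    integrableOn_besselIntegrand hf hg hφc (fun z hz => (hfb z hz).2) (fun z hz => (hgb z hz).1)
      (fun z hz => (hgb z hz).2.2) hφ hb1 hφ0 hr hs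
  have hii : ∀ a c : ℝ, 0 ≤ a → 0 ≤ c →
      IntervalIntegrable (besselIntegrand f₁ g g₁ φ r s) volume a c := fun a c ha hc =>
    (intervalIntegrable_iff.2 (hi.mono_set fun x hx => (le_min ha hc).trans_lt hx.1))
  rw [integral_besselIntegrand_eq hb0.le hφ0]
  have hsmall : ∀ δ : ℝ, 0 < δ → δ < κ → δ * r ≤ 1 →
      |∫ l in (0:ℝ)..b, besselIntegrand f₁ g g₁ φ r s l| ≤
        2 * C * K * ((r ^ 2 + s ^ 2) / (r * (r ^ 2 - s ^ 2) ^ 2)) + B +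
          (L + 2 * C * K * X) * δ := by
    intro δ hδ hδκ hδr
    have hδb : δ ≤ b := hδκ.le.trans hκb
    have hsub : Set.uIcc δ b ⊆ Set.Ioi 0 := fun l hl => (lt_min hδ hb0).trans_le hl.1
    have hR : IntervalIntegrable (lommelRemainder f f₁ g g₁ w w₁ r s) volume δ b :=
      ((continuousOn_lommelRemainder hf hg hwc hw₁c hr hs).mono hsub).intervalIntegrable
    have ftc := intervalIntegral.integral_eq_sub_of_hasDerivAt (a := δ) (b := b)
      (fun l hl => hasDerivAt_lommel hf hg hφd hwd hr hs (hsub hl) hD)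
      ((hii δ b hδ.le hb0.le).add hR)
    have e1 : ∫ l in δ..b, (besselIntegrand f₁ g g₁ φ r s l + lommelRemainder f f₁ g g₁ w w₁ r s l)
        = -lommelPrimitive f f₁ g g₁ r s δ := by
      refine ftc.trans ?_
      simp [lommelBoundary, hwb, hw0 δ hδ hδκ, hφ0 b le_rfl, hφ1 δ hδ hδκ]
    rw [intervalIntegral.integral_add (hii δ b hδ.le hb0.le) hR] at e1
    have e2 : ‖∫ l in δ..b, lommelRemainder f f₁ g g₁ w w₁ r s l‖ ≤ B * |b - δ| := by
      refine intervalIntegral.norm_integral_le_of_norm_le_const fun l hl => ?_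
      rw [Set.uIoc_of_le hδb] at hl
      exact hRb l (hδ.trans hl.1) (hl.2.trans hb1)
    have e3 : B * |b - δ| ≤ B := by
      refine mul_le_of_le_one_right hB0 ?_
      rw [abs_of_nonneg (by linarith)]
      linarith
    have e4 := hL δ hδ (hδb.trans hb1) hδr
    have e5 : ‖∫ l in (0:ℝ)..δ, besselIntegrand f₁ g g₁ φ r s l‖ ≤ 2 * C * K * X * |δ - 0| := by
      refine intervalIntegral.norm_integral_le_of_norm_le_const fun l hl => ?_
      rw [Set.uIoc_of_le hδ.le] at hl
      exact abs_besselIntegrand_le (fun z hz => (hfb z hz).2) (fun z hz => (hgb z hz).1)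
        (fun z hz => (hgb z hz).2.2) hφ hr hs hl.1 (hl.2.trans (hδb.trans hb1))
    rw [sub_zero, abs_of_pos hδ] at e5
    have e6 := intervalIntegral.integral_add_adjacent_intervals (hii 0 δ le_rfl hδ.le)
      (hii δ b hδ.le hb0.le)
    rw [Real.norm_eq_abs] at e2 e5
    rw [abs_le] at *
    constructor <;> linarith [e2.1, e2.2, e4.1, e4.2, e5.1, e5.2]
  have hlim : Tendsto (fun δ : ℝ => 2 * C * K * ((r ^ 2 + s ^ 2) / (r * (r ^ 2 - s ^ 2) ^ 2)) + B +
      (L + 2 * C * K * X) * δ) (nhdsWithin 0 (Set.Ioi 0))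
      (nhds (2 * C * K * ((r ^ 2 + s ^ 2) / (r * (r ^ 2 - s ^ 2) ^ 2)) + B +
        (L + 2 * C * K * X) * 0)) :=
    ((by fun_prop : Continuous fun δ : ℝ => 2 * C * K * ((r ^ 2 + s ^ 2) /
      (r * (r ^ 2 - s ^ 2) ^ 2)) + B + (L + 2 * C * K * X) * δ).tendsto 0).mono_left
      nhdsWithin_le_nhds
  rw [mul_zero, add_zero] at hlim
  refine ge_of_tendsto hlim ?_
  have hpos : 0 < min κ (1 / r) := lt_min hκ (by positivity)
  filter_upwards [Ioo_mem_nhdsGT hpos] with δ hδ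
  exact hsmall δ hδ.1 (hδ.2.trans_le (min_le_left _ _))
    ((le_div_iff₀ hr).1 (hδ.2.le.trans (min_le_right _ _)))

/-- The weight on the right-hand side of the estimate, with the first exponent equal to `2`. -/
noncomputable def besselWeight (r s : ℝ) : ℝ :=
  1 / (√(r * s) * (1 + (r - s) ^ 2)) + 1 / (r * (1 + (r + s) ^ 2))

theorem weight_le_two_div_sqrt {r s : ℝ} (hr : 1 ≤ r) (hs : 0 < s) :
    (1 / r + 1 / √r) * (1 / √(1 + s)) ≤ 2 / √(r * s) := by
  have hr0 : 0 < r := by linarith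
  have h1 : 1 / r ≤ 1 / √r := by
    have : √r ≤ r := Real.sqrt_le_iff.2 ⟨hr0.le, by nlinarith⟩
    gcongr
  have h2 : 1 / √(1 + s) ≤ 1 / √s := by
    have : √s ≤ √(1 + s) := Real.sqrt_le_sqrt (by linarith)
    have : 0 < √s := by positivity
    gcongr
  calc (1 / r + 1 / √r) * (1 / √(1 + s)) ≤ (1 / √r + 1 / √r) * (1 / √s) := by gcongr
    _ = _ := by rw [Real.sqrt_mul hr0.le]; field_simp; norm_num

theorem weight_le_two_div {r s : ℝ} (hr : 0 < r) (hr1 : r ≤ 1) (hs : 0 < s) :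
    (1 / r + 1 / √r) * (1 / √(1 + s)) ≤ 2 / r := by
  have h1 : 1 / √r ≤ 1 / r := by
    have : r ≤ √r := Real.le_sqrt_of_sq_le (by nlinarith)
    gcongr
  have h2 : 1 / √(1 + s) ≤ 1 := by
    rw [div_le_one (by positivity)]
    exact Real.one_le_sqrt.2 (by linarith)
  calc (1 / r + 1 / √r) * (1 / √(1 + s)) ≤ (1 / r + 1 / r) * 1 := by gcongr
    _ = _ := by ring

theorem le_besselWeight_left {r s c k : ℝ} (hr : 0 < r) (hs : 0 < s) (hc : 0 < c)
    (hk : 0 ≤ k) (h : 1 + (r - s) ^ 2 ≤ k * c) :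
    1 / √(r * s) * (1 / c) ≤ k * besselWeight r s := by
  have h1 : 1 / √(r * s) * (1 / c) ≤ k * (1 / (√(r * s) * (1 + (r - s) ^ 2))) := by
    rw [one_div_mul_one_div, mul_one_div, div_le_div_iff₀ (by positivity) (by positivity)]
    have : 0 < √(r * s) := by positivity
    nlinarith
  have h2 : 0 ≤ k * (1 / (r * (1 + (r + s) ^ 2))) := by positivity
  rw [besselWeight]
  linarith

theorem le_besselWeight_right {r s c k : ℝ} (hr : 0 < r) (hc : 0 < c)
    (hk : 0 ≤ k) (h : 1 + (r + s) ^ 2 ≤ k * c) :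
    1 / r * (1 / c) ≤ k * besselWeight r s := by
  have h1 : 1 / r * (1 / c) ≤ k * (1 / (r * (1 + (r + s) ^ 2))) := by
    rw [one_div_mul_one_div, mul_one_div, div_le_div_iff₀ (by positivity) (by positivity)]
    nlinarith
  have h2 : 0 ≤ k * (1 / (√(r * s) * (1 + (r - s) ^ 2))) := by positivity
  rw [besselWeight]
  linarith

theorem weight_div_sq_le {r s : ℝ} (hr : 0 < r) (hs : 0 < s) (h : 1 ≤ |r - s|) :
    (1 / r + 1 / √r) * (1 / √(1 + s)) / (r - s) ^ 2 ≤ 20 * besselWeight r s := by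
  have hm : 1 ≤ (r - s) ^ 2 := by
    rw [← sq_abs]
    nlinarith
  have hm0 : 0 < (r - s) ^ 2 := by linarith
  rcases le_total 1 r with h1 | h1
  · calc _ ≤ 2 / √(r * s) / (r - s) ^ 2 := by gcongr; exact weight_le_two_div_sqrt h1 hs
      _ = 2 * (1 / √(r * s) * (1 / (r - s) ^ 2)) := by ring
      _ ≤ 2 * (10 * besselWeight r s) := by
        refine mul_le_mul_of_nonneg_left ?_ two_pos.le
        exact le_besselWeight_left (k := 10) hr hs hm0 (by norm_num) (by linarith)
      _ = _ := by ring
  · calc _ ≤ 2 / r / (r - s) ^ 2 := by gcongr; exact weight_le_two_div hr h1 hs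
      _ = 2 * (1 / r * (1 / (r - s) ^ 2)) := by ring
      _ ≤ 2 * (10 * besselWeight r s) := by
        refine mul_le_mul_of_nonneg_left ?_ two_pos.le
        refine le_besselWeight_right (k := 10) hr hm0 (by norm_num) ?_
        have hsr : r + 1 ≤ s := by
          rcases le_abs.1 h with h | h <;> linarith
        nlinarith
      _ = _ := by ring

theorem weight_le_of_lt_one {r s : ℝ} (hr : 0 < r) (hs : 0 < s) (h : |r - s| < 1) :
    (1 / r + 1 / √r) * (1 / √(1 + s)) ≤ 20 * besselWeight r s := by
  obtain ⟨ha, hb⟩ := abs_lt.1 h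
  rcases le_total 1 r with h1 | h1
  · calc _ ≤ 2 / √(r * s) := weight_le_two_div_sqrt h1 hs
      _ = 2 * (1 / √(r * s) * (1 / 1)) := by ring
      _ ≤ 2 * (10 * besselWeight r s) := by
        refine mul_le_mul_of_nonneg_left ?_ two_pos.le
        exact le_besselWeight_left (k := 10) hr hs one_pos (by norm_num) (by nlinarith)
      _ = _ := by ring
  · calc _ ≤ 2 / r := weight_le_two_div hr h1 hs
      _ = 2 * (1 / r * (1 / 1)) := by ring
      _ ≤ 2 * (10 * besselWeight r s) := by
        refine mul_le_mul_of_nonneg_left ?_ two_pos.le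
        exact le_besselWeight_right (k := 10) hr one_pos (by norm_num) (by nlinarith)
      _ = _ := by ring

theorem endpoint_weight_le {r s : ℝ} (hr : 0 < r) (hs : 0 < s) (h : 1 ≤ |r - s|) :
    (r ^ 2 + s ^ 2) / (r * (r ^ 2 - s ^ 2) ^ 2) ≤ 20 * besselWeight r s := by
  have hm : 1 ≤ (r - s) ^ 2 := by
    rw [← sq_abs]
    nlinarith
  have hm0 : 0 < (r - s) ^ 2 := by linarith
  have h0 : (r ^ 2 + s ^ 2) / (r * (r ^ 2 - s ^ 2) ^ 2) ≤ 1 / r * (1 / (r - s) ^ 2) := by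
    have e : r * (r ^ 2 - s ^ 2) ^ 2 = r * (r - s) ^ 2 * (r + s) ^ 2 := by ring
    rw [e, one_div_mul_one_div, div_le_div_iff₀ (by positivity) (by positivity), one_mul, mul_comm]
    gcongr
    nlinarith [mul_pos hr hs]
  refine h0.trans ?_
  rcases le_total s (4 * r) with h1 | h1
  · have h2 : 1 / r ≤ 2 * (1 / √(r * s)) := by
      rw [mul_one_div, div_le_div_iff₀ hr (by positivity), one_mul]
      exact Real.sqrt_le_iff.2 ⟨by positivity, by nlinarith⟩
    calc _ ≤ 2 * (1 / √(r * s)) * (1 / (r - s) ^ 2) := by gcongr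
      _ = 2 * (1 / √(r * s) * (1 / (r - s) ^ 2)) := by ring
      _ ≤ 2 * (10 * besselWeight r s) := by
        refine mul_le_mul_of_nonneg_left ?_ two_pos.le
        exact le_besselWeight_left (k := 10) hr hs hm0 (by norm_num) (by linarith)
      _ = _ := by ring
  · exact le_besselWeight_right hr hm0 (by norm_num) (by nlinarith)

theorem exists_abs_integral_besselIntegrand_le {f f₁ g g₁ φ w w₁ : ℝ → ℝ} {C K W κ b : ℝ}
    (hf : SolvesBessel f f₁) (hg : SolvesBessel g g₁)
    (hfb : ∀ z : ℝ, 0 < z → |f z| ≤ C * (1 / z + 1 / √z) ∧ |f₁ z| ≤ C * (1 / z + 1 / √z))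
    (hgb : ∀ z : ℝ, 0 < z →
      |g z| ≤ K / √(1 + z) ∧ |g₁ z| ≤ K / √(1 + z) ∧ |g₁ z| ≤ K * z / √(1 + z))
    (hφd : ∀ l, HasDerivAt φ (w l) l) (hwd : ∀ l, HasDerivAt w (w₁ l) l) (hw₁c : Continuous w₁)
    (hφ : ∀ l, φ l ∈ Set.Icc (0:ℝ) 1) (hκ : 0 < κ) (hκb : κ ≤ b) (hb1 : b ≤ 1)
    (hφ0 : ∀ l, b ≤ l → φ l = 0) (hφ1 : ∀ l, 0 < l → l < κ → φ l = 1)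
    (hw0 : ∀ l, 0 < l → l < κ → w l = 0) (hw₁0 : ∀ l, 0 < l → l < κ → w₁ l = 0)
    (hwb : w b = 0) (hW : ∀ l ∈ Set.Icc (0:ℝ) 1, |w l| ≤ W ∧ |w₁ l| ≤ W) :
    ∃ M : ℝ, 0 < M ∧ ∀ r s : ℝ, 0 < r → 0 < s →
      |∫ l in Set.Ioi (0:ℝ), besselIntegrand f₁ g g₁ φ r s l| ≤ M * besselWeight r s := by
  have hb0 : 0 < b := hκ.trans_le hκb
  have hC : 0 ≤ C := by
    have := (abs_nonneg _).trans (hfb 1 one_pos).1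
    norm_num at this
    linarith
  have hK : 0 ≤ K := by
    have := (abs_nonneg _).trans (hgb 1 one_pos).1
    rwa [le_div_iff₀ (by positivity), zero_mul] at this
  have hW0 : 0 ≤ W := (abs_nonneg _).trans (hW 0 (by simp)).1
  refine ⟨2 * C * K * 20 + 12 * (C * K / κ ^ 2) * W * 20 + 1, by positivity,
    fun r s hr hs => ?_⟩
  have hT : 0 ≤ besselWeight r s := by
    rw [besselWeight]
    positivity
  have hU : 0 ≤ 12 * (C * K / κ ^ 2) * W := by positivity
  rcases le_or_gt 1 |r - s| with h | h
  · refine (abs_integral_besselIntegrand_le_of_one_le hf hg hfb hgb hφd hwd hw₁c hφ hκ hκb hb1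
      hφ0 hφ1 hw0 hw₁0 hwb hW hr hs h).trans ?_
    calc _ = 2 * C * K * ((r ^ 2 + s ^ 2) / (r * (r ^ 2 - s ^ 2) ^ 2)) +
          12 * (C * K / κ ^ 2) * W *
            ((1 / r + 1 / √r) * (1 / √(1 + s)) / (r - s) ^ 2) := by ring
      _ ≤ 2 * C * K * (20 * besselWeight r s) +
          12 * (C * K / κ ^ 2) * W * (20 * besselWeight r s) := by
        gcongr
        · exact endpoint_weight_le hr hs h
        · exact weight_div_sq_le hr hs h
      _ ≤ _ := by nlinarith
  · rw [integral_besselIntegrand_eq hb0.le hφ0]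
    have e : ‖∫ l in (0:ℝ)..b, besselIntegrand f₁ g g₁ φ r s l‖ ≤
        2 * C * K * ((1 / r + 1 / √r) * (1 / √(1 + s))) * |b - 0| := by
      refine intervalIntegral.norm_integral_le_of_norm_le_const fun l hl => ?_
      rw [Set.uIoc_of_le hb0.le] at hl
      exact abs_besselIntegrand_le (fun z hz => (hfb z hz).2) (fun z hz => (hgb z hz).1)
        (fun z hz => (hgb z hz).2.2) hφ hr hs hl.1 (hl.2.trans hb1)
    rw [sub_zero, abs_of_pos hb0, Real.norm_eq_abs] at e
    calc _ ≤ 2 * C * K * ((1 / r + 1 / √r) * (1 / √(1 + s))) * b := e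
      _ ≤ 2 * C * K * (20 * besselWeight r s) * 1 :=
        mul_le_mul (mul_le_mul_of_nonneg_left (weight_le_of_lt_one hr hs h) (by positivity)) hb1
          hb0.le (by positivity)
      _ ≤ _ := by nlinarith

theorem besselWeight_le {r s ε : ℝ} (hr : 0 < r) (hs : 0 < s) (hε : 0 < ε) :
    besselWeight r s ≤ 1 / (√(r * s) * √(1 + (r - s) ^ 2) ^ (2 - ε)) +
      1 / (r * (1 + (r + s) ^ 2)) := by
  have h1 : 1 ≤ √(1 + (r - s) ^ 2) := Real.one_le_sqrt.2 (by nlinarith [sq_nonneg (r - s)])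
  have h2 : √(1 + (r - s) ^ 2) ^ (2 - ε) ≤ 1 + (r - s) ^ 2 := by
    refine (Real.rpow_le_rpow_of_exponent_le h1 (by norm_num; linarith : 2 - ε ≤ (2:ℕ))).trans_eq ?_
    rw [Real.rpow_natCast, Real.sq_sqrt (by positivity)]
  rw [besselWeight]
  gcongr

/-- The decay estimate for the cutoff of the theorem, against the second derivative of `J0`. -/
theorem exists_abs_integral_J0_le {lam₁ : ℝ} (hlam₁ : lam₁ ∈ Set.Ioc (0:ℝ) (1 / 4))
    {χ : ℝ → ℝ} (hχ : ContDiff ℝ (⊤ : ℕ∞) χ) (hχ01 : ∀ t, χ t ∈ Set.Icc (0:ℝ) 1)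
    (hχ1 : ∀ t ∈ Set.Icc (0:ℝ) lam₁, χ t = 1) (hχ0 : ∀ t : ℝ, 2 * lam₁ ≤ t → χ t = 0)
    {f f₁ : ℝ → ℝ} (hf : SolvesBessel f f₁) {A : ℝ}
    (hA : ∀ z : ℝ, 0 < z → z ≤ 1 → |f z| ≤ A / z) :
    ∃ M : ℝ, 0 < M ∧ ∀ r s : ℝ, 0 < r → 0 < s →
      IntegrableOn (besselIntegrand f₁ J0 J0' χ r s) (Set.Ioi 0) ∧
      |∫ l in Set.Ioi (0:ℝ), besselIntegrand f₁ J0 J0' χ r s l| ≤ M * besselWeight r s := by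
  obtain ⟨h0, h4⟩ := hlam₁
  obtain ⟨C, -, hC⟩ := hf.exists_bound hA
  obtain ⟨K, -, hK⟩ := exists_bound_J0
  have hd1 : ContDiff ℝ (⊤ : ℕ∞) (deriv χ) := (contDiff_infty_iff_deriv.1 hχ).2
  have hd2 : ContDiff ℝ (⊤ : ℕ∞) (deriv (deriv χ)) := (contDiff_infty_iff_deriv.1 hd1).2
  have hφd : ∀ l, HasDerivAt χ (deriv χ l) l := fun l =>
    ((contDiff_infty_iff_deriv.1 hχ).1 l).hasDerivAt
  have hwd : ∀ l, HasDerivAt (deriv χ) (deriv (deriv χ) l) l := fun l =>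
    ((contDiff_infty_iff_deriv.1 hd1).1 l).hasDerivAt
  have hw0 : ∀ l, 0 < l → l < lam₁ → deriv χ l = 0 := fun l hl hl1 => by
    have : χ =ᶠ[nhds l] fun _ => (1:ℝ) := by
      filter_upwards [Ioo_mem_nhds hl hl1] with x hx using hχ1 x ⟨hx.1.le, hx.2.le⟩
    rw [this.deriv_eq, deriv_const]
  have hw₁0 : ∀ l, 0 < l → l < lam₁ → deriv (deriv χ) l = 0 := fun l hl hl1 => by
    have : deriv χ =ᶠ[nhds l] fun _ => (0:ℝ) := by
      filter_upwards [Ioo_mem_nhds hl hl1] with x hx using hw0 x hx.1 hx.2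
    rw [this.deriv_eq, deriv_const]
  have hwb : deriv χ (2 * lam₁) = 0 := by
    refine IsLocalMin.deriv_eq_zero (Eventually.of_forall fun x => ?_)
    rw [hχ0 _ le_rfl]
    exact (hχ01 x).1
  obtain ⟨W₀, hW₀⟩ := isCompact_Icc.exists_bound_of_continuousOn (s := Set.Icc (0:ℝ) 1)
    hd1.continuous.continuousOn
  obtain ⟨W₁, hW₁⟩ := isCompact_Icc.exists_bound_of_continuousOn (s := Set.Icc (0:ℝ) 1)
    hd2.continuous.continuousOn
  obtain ⟨M, hM, hMb⟩ := exists_abs_integral_besselIntegrand_le hf solvesBessel_J0 hC hK hφd hwd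
    hd2.continuous hχ01 h0 (by linarith : lam₁ ≤ 2 * lam₁) (by linarith) hχ0
    (fun l hl hl1 => hχ1 l ⟨hl.le, hl1.le⟩) hw0 hw₁0 hwb
    (W := max W₀ W₁) (fun l hl => ⟨(hW₀ l hl).trans (le_max_left _ _),
      (hW₁ l hl).trans (le_max_right _ _)⟩)
  exact ⟨M, hM, fun r s hr hs => ⟨integrableOn_besselIntegrand hf solvesBessel_J0 hχ.continuous
    (fun z hz => (hC z hz).2) (fun z hz => (hK z hz).1) (fun z hz => (hK z hz).2.2) hχ01
    (by linarith : 2 * lam₁ ≤ 1) hχ0 hr hs, hMb r s hr hs⟩⟩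

theorem exists_solvesBessel_Y0 {Y0 : ℝ → ℝ}
    (hY0 : ∀ z : ℝ, 0 < z →
      Tendsto (fun T : ℝ => ∫ t in (0:ℝ)..T, Real.cos (z * Real.cosh t)) atTop
        (nhds (-(Real.pi / 2) * Y0 z))) :
    ∃ Y₁ : ℝ → ℝ, SolvesBessel Y0 Y₁ ∧ ∃ A : ℝ, ∀ z : ℝ, 0 < z → z ≤ 1 → |Y0 z| ≤ A / z := by
  obtain ⟨Z, hZ, hb⟩ := exists_solvesBessel_of_tendsto (Y := fun z => -(Real.pi / 2) * Y0 z) hY0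
  have e : ∀ z, -(2 / Real.pi) * (-(Real.pi / 2) * Y0 z) = Y0 z := fun z => by
    field_simp
  have hY := hZ.const_mul (-(2 / Real.pi))
  simp only [e] at hY
  refine ⟨_, hY, 2 / Real.pi * 3, fun z hz hz1 => ?_⟩
  have h3 : 1 + 2 / z ≤ 3 / z := by
    rw [le_div_iff₀ hz, add_mul, div_mul_cancel₀ _ hz.ne']
    linarith
  have := (hb z hz).trans h3
  rw [← e z, abs_mul, abs_neg, abs_of_pos (by positivity : 0 < 2 / Real.pi)]
  calc _ ≤ 2 / Real.pi * (3 / z) := by gcongr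
    _ = _ := by ring

/-- the oscillatory integral bound
`|∫₀^∞ (H₀⁻)′(λr) J₀″(λs) λ² χ(λ) dλ| ≲ 1/(√(rs)⟨r-s⟩^{2-ε}) + 1/(r⟨r+s⟩²)`.
Here `Y0` is the Bessel function of the second kind of order zero, characterized by
the improper-integral representation `Y₀(z) = -(2/π) ∫₀^∞ cos(z cosh t) dt` for `z > 0`,
and `H0m = J₀ - i Y₀` on `(0,∞)` is the Hankel function of order zero. -/
theorem stmt_4
    (Y0 : ℝ → ℝ)
    (hY0 : ∀ z : ℝ, 0 < z →
      Tendsto (fun T : ℝ => ∫ t in (0:ℝ)..T, Real.cos (z * Real.cosh t)) atTop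
        (nhds (-(Real.pi / 2) * Y0 z)))
    (H0m : ℝ → ℂ)
    (hH0m : ∀ z : ℝ, 0 < z → H0m z = (J0 z : ℂ) - Complex.I * (Y0 z : ℂ))
    (lam₁ : ℝ) (hlam₁ : lam₁ ∈ Set.Ioc (0:ℝ) (1/4))
    (χ : ℝ → ℝ) (hχ : ContDiff ℝ (⊤ : ℕ∞) χ)
    (hχ01 : ∀ t, χ t ∈ Set.Icc (0:ℝ) 1)
    (hχ1 : ∀ t ∈ Set.Icc (0:ℝ) lam₁, χ t = 1)
    (hχ0 : ∀ t : ℝ, 2 * lam₁ ≤ t → χ t = 0)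
    (ε : ℝ) (hε : ε ∈ Set.Ioo (0:ℝ) 1) :
    ∃ C : ℝ, 0 < C ∧ ∀ r s : ℝ, 0 < r → 0 < s →
      ‖∫ l in Set.Ioi (0:ℝ),
          deriv H0m (l * r) * (Complex.ofReal (deriv (deriv J0) (l * s))) * (l : ℂ) ^ 2 *
            (χ l : ℂ)‖ ≤
        C * (1 / (Real.sqrt (r * s) * Real.sqrt (1 + (r - s) ^ 2) ^ (2 - ε)) +
             1 / (r * (1 + (r + s) ^ 2))) := by
  obtain ⟨Y₁, hY, A, hA⟩ := exists_solvesBessel_Y0 hY0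
  obtain ⟨M, hM, hMb⟩ := exists_abs_integral_J0_le hlam₁ hχ hχ01 hχ1 hχ0 solvesBessel_J0 (A := 1)
    (fun z hz hz1 => (abs_J0_le_one z).trans ((one_le_div hz).2 hz1))
  obtain ⟨N, hN, hNb⟩ := exists_abs_integral_J0_le hlam₁ hχ hχ01 hχ1 hχ0 hY hA
  have dH : ∀ z : ℝ, 0 < z → deriv H0m z = (J0' z : ℂ) - Complex.I * (Y₁ z : ℂ) := by
    intro z hz
    have hev : H0m =ᶠ[nhds z] fun x => (J0 x : ℂ) - Complex.I * (Y0 x : ℂ) := by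
      filter_upwards [Ioi_mem_nhds hz] with x hx using hH0m x hx
    rw [hev.deriv_eq]
    exact ((hasDerivAt_J0 z).ofReal_comp.sub
      ((hY z hz).1.ofReal_comp.const_mul Complex.I)).deriv
  have dJ : ∀ z : ℝ, 0 < z → deriv (deriv J0) z = -J0' z / z - J0 z := by
    intro z hz
    rw [show deriv J0 = J0' from funext fun x => (hasDerivAt_J0 x).deriv]
    exact (solvesBessel_J0 z hz).2.deriv
  refine ⟨M + N, by positivity, fun r s hr hs => ?_⟩
  obtain ⟨iJ, bJ⟩ := hMb r s hr hs
  obtain ⟨iY, bY⟩ := hNb r s hr hs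
  have e : ∫ l in Set.Ioi (0:ℝ), deriv H0m (l * r) *
      (Complex.ofReal (deriv (deriv J0) (l * s))) * (l : ℂ) ^ 2 * (χ l : ℂ) =
      ((∫ l in Set.Ioi (0:ℝ), besselIntegrand J0' J0 J0' χ r s l : ℝ) : ℂ) -
        Complex.I * ((∫ l in Set.Ioi (0:ℝ), besselIntegrand Y₁ J0 J0' χ r s l : ℝ) : ℂ) := by
    rw [← integral_complex_ofReal, ← integral_complex_ofReal, ← integral_const_mul,
      ← integral_sub iJ.ofReal (iY.ofReal.const_mul _)]
    refine setIntegral_congr_fun measurableSet_Ioi fun l hl => ?_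
    have hl' : 0 < l := hl
    simp only [dH _ (mul_pos hl' hr), dJ _ (mul_pos hl' hs), besselIntegrand]
    push_cast
    ring
  rw [e]
  calc _ ≤ ‖((∫ l in Set.Ioi (0:ℝ), besselIntegrand J0' J0 J0' χ r s l : ℝ) : ℂ)‖ +
        ‖Complex.I * ((∫ l in Set.Ioi (0:ℝ), besselIntegrand Y₁ J0 J0' χ r s l : ℝ) : ℂ)‖ :=
        norm_sub_le _ _
    _ ≤ M * besselWeight r s + N * besselWeight r s := by
      rw [norm_mul, Complex.norm_I, one_mul, Complex.norm_real, Complex.norm_real]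
      exact add_le_add bJ bY
    _ = (M + N) * besselWeight r s := by ring
    _ ≤ _ := mul_le_mul_of_nonneg_left (besselWeight_le hr hs hε.1) (by positivity)
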